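/- arXiv:2107.05480 — 8 statements merged into one kernel-verified Lean document; each statement's English description precedes it below -/
import Mathlib

section
/- For any 0 < 𝔞 < 𝔟 < ∞ there exists a C² function u : [𝔞,𝔟] → ℝ with u > 0 on (𝔞,𝔟), u(𝔞) = u(𝔟) = 0, and u''(r) = M₊(−(N−1)·m₊(u'(r))/r − r^a·u(r)^p) for all r ∈ (𝔞,𝔟); that is, the Hénon-type equation 𝓜⁺(D²u) + |x|^a u^p = 0 for the Pucci maximal operator has a positive radial solution vanishing on the boundary of the annulus {x ∈ ℝ^N : 𝔞 < |x| < 𝔟}. -/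
open Real Set

/-- `m₊(s) = λs` for `s ≤ 0`, `Λs` for `s > 0`. -/
noncomputable def mplus (lam Lam s : ℝ) : ℝ := if s ≤ 0 then lam * s else Lam * s

/-- `M₊(s) = s/λ` for `s ≤ 0`, `s/Λ` for `s > 0`. -/
noncomputable def Mplus (lam Lam s : ℝ) : ℝ := if s ≤ 0 then s / lam else s / Lam

section PucciScalars

variable {lam Lam : ℝ}

lemma mplus_eq_max (hlL : lam ≤ Lam) (s : ℝ) : mplus lam Lam s = max (lam * s) (Lam * s) := by
  unfold mplus
  split_ifs with h
  · exact (max_eq_left (mul_le_mul_of_nonpos_right hlL h)).symm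
  · exact (max_eq_right (mul_le_mul_of_nonneg_right hlL (not_le.1 h).le)).symm

lemma Mplus_eq_min (hlam : 0 < lam) (hlL : lam ≤ Lam) (s : ℝ) :
    Mplus lam Lam s = min (s / lam) (s / Lam) := by
  have hinv : Lam⁻¹ ≤ lam⁻¹ := inv_anti₀ hlam hlL
  unfold Mplus
  simp only [div_eq_mul_inv]
  split_ifs with h
  · exact (min_eq_left (mul_le_mul_of_nonpos_left hinv h)).symm
  · exact (min_eq_right (mul_le_mul_of_nonneg_left hinv (not_le.1 h).le)).symm

lemma mplus_zero : mplus lam Lam 0 = 0 := by simp [mplus]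

lemma Mplus_zero : Mplus lam Lam 0 = 0 := by simp [Mplus]

lemma mplus_mul_of_pos {c : ℝ} (hc : 0 < c) (s : ℝ) :
    mplus lam Lam (c * s) = c * mplus lam Lam s := by
  have h : c * s ≤ 0 ↔ s ≤ 0 := by
    simpa using mul_le_mul_iff_right₀ (b := s) (c := 0) hc
  simp only [mplus, h]
  split_ifs <;> ring

lemma Mplus_mul_of_pos {c : ℝ} (hc : 0 < c) (s : ℝ) :
    Mplus lam Lam (c * s) = c * Mplus lam Lam s := by
  have h : c * s ≤ 0 ↔ s ≤ 0 := by
    simpa using mul_le_mul_iff_right₀ (b := s) (c := 0) hc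
  simp only [Mplus, h]
  split_ifs <;> ring

lemma mul_le_mplus (hlL : lam ≤ Lam) (s : ℝ) : lam * s ≤ mplus lam Lam s := by
  rw [mplus_eq_max hlL]; exact le_max_left _ _

lemma Mplus_le_div (hlam : 0 < lam) (hlL : lam ≤ Lam) (s : ℝ) : Mplus lam Lam s ≤ s / lam := by
  rw [Mplus_eq_min hlam hlL]; exact min_le_left _ _

lemma Mplus_mono (hlam : 0 < lam) (hlL : lam ≤ Lam) : Monotone (Mplus lam Lam) := by
  intro s t hst
  have hLam : 0 < Lam := hlam.trans_le hlL
  rw [Mplus_eq_min hlam hlL, Mplus_eq_min hlam hlL]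
  gcongr

lemma Mplus_neg (hlam : 0 < lam) {s : ℝ} (hs : s < 0) : Mplus lam Lam s < 0 := by
  rw [Mplus, if_pos hs.le]; exact div_neg_of_neg_of_pos hs hlam

lemma Mplus_pos (hlam : 0 < lam) (hlL : lam ≤ Lam) {s : ℝ} (hs : 0 < s) :
    0 < Mplus lam Lam s := by
  rw [Mplus, if_neg hs.not_ge]; exact div_pos hs (hlam.trans_le hlL)

lemma abs_mplus_sub_le (hlam : 0 < lam) (hlL : lam ≤ Lam) (s t : ℝ) :
    |mplus lam Lam s - mplus lam Lam t| ≤ Lam * |s - t| := by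
  have hLam : 0 < Lam := hlam.trans_le hlL
  rw [mplus_eq_max hlL, mplus_eq_max hlL]
  refine (abs_max_sub_max_le_max _ _ _ _).trans (max_le ?_ ?_)
  · rw [← mul_sub, abs_mul, abs_of_pos hlam]; gcongr
  · rw [← mul_sub, abs_mul, abs_of_pos hLam]

lemma abs_Mplus_sub_le (hlam : 0 < lam) (hlL : lam ≤ Lam) (s t : ℝ) :
    |Mplus lam Lam s - Mplus lam Lam t| ≤ |s - t| / lam := by
  have hLam : 0 < Lam := hlam.trans_le hlL
  rw [Mplus_eq_min hlam hlL, Mplus_eq_min hlam hlL]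
  refine (abs_min_sub_min_le_max _ _ _ _).trans (max_le ?_ ?_)
  · rw [← sub_div, abs_div, abs_of_pos hlam]
  · rw [← sub_div, abs_div, abs_of_pos hLam]; gcongr

lemma continuous_mplus (hlL : lam ≤ Lam) : Continuous (mplus lam Lam) := by
  rw [show mplus lam Lam = _ from funext (mplus_eq_max hlL)]; fun_prop

lemma continuous_Mplus (hlam : 0 < lam) (hlL : lam ≤ Lam) : Continuous (Mplus lam Lam) := by
  rw [show Mplus lam Lam = _ from funext (Mplus_eq_min hlam hlL)]; fun_prop

end PucciScalars

/-- A bounded, globally Lipschitz vector field has a flow on every compact time interval, and the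
flow is Lipschitz in the initial value. -/
lemma exists_flow_of_bounded_of_lipschitz {E : Type*} [NormedAddCommGroup E] [NormedSpace ℝ E]
    [CompleteSpace E] {F : ℝ → E → E} {K C : NNReal} (hlip : ∀ t, LipschitzWith K (F t))
    (hcont : ∀ x, Continuous (F · x)) (hbound : ∀ t x, ‖F t x‖ ≤ C)
    {tmin tmax : ℝ} (t₀ : Icc tmin tmax) (r : NNReal) :
    ∃ α : E → ℝ → E, (∀ x ∈ Metric.closedBall (0 : E) r, α x t₀ = x ∧
      ∀ t ∈ Icc tmin tmax, HasDerivWithinAt (α x) (F t (α x t)) (Icc tmin tmax) t) ∧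
      ∃ L' : NNReal, ∀ t ∈ Icc tmin tmax, LipschitzOnWith L' (α · t) (Metric.closedBall 0 r) := by
  have h0 : 0 ≤ C * max (tmax - t₀) (t₀ - tmin) :=
    mul_nonneg C.2 (le_max_of_le_left (sub_nonneg.2 t₀.2.2))
  have hPL : IsPicardLindelof F t₀ (0 : E) (r + NNReal.mk _ h0) r C K :=
    { lipschitzOnWith := fun t _ => (hlip t).lipschitzOnWith
      continuousOn := fun x _ => (hcont x).continuousOn
      norm_le := fun t _ x _ => hbound t x
      mul_max_le := by simp }
  exact hPL.exists_forall_mem_closedBall_eq_hasDerivWithinAt_lipschitzOnWith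

/-- The right-hand side of the radial equation for `u`, with the nonlinearity multiplied by `μ` and
extended by zero to negative values of `u`. -/
noncomputable def radialForce (n lam Lam p a μ t u v : ℝ) : ℝ :=
  Mplus lam Lam (-(n * mplus lam Lam v) / t - μ * (t ^ a * (max u 0) ^ p))

lemma radialForce_eq_zero {n lam Lam p a μ t u : ℝ} (hp : p ≠ 0) (h : μ = 0 ∨ u ≤ 0) :
    radialForce n lam Lam p a μ t u 0 = 0 := by
  have h' : μ * (t ^ a * (max u 0) ^ p) = 0 := by
    rcases h with rfl | h
    · simp
    · simp [max_eq_right h, Real.zero_rpow hp]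
  rw [radialForce, h', mplus_zero]
  simp [Mplus_zero]

lemma abs_rpow_sub_rpow_le {p L x y : ℝ} (hp : 1 < p) (hx : x ∈ Icc 0 L) (hy : y ∈ Icc 0 L) :
    |x ^ p - y ^ p| ≤ p * L ^ (p - 1) * |x - y| := by
  refine (convex_Icc 0 L).norm_image_sub_le_of_norm_hasDerivWithin_le
    (f := fun z : ℝ => z ^ p) (f' := fun z => p * z ^ (p - 1))
    (fun z _ => (Real.hasDerivAt_rpow_const (Or.inr hp.le)).hasDerivWithinAt) (fun z hz => ?_) hy hx
  rw [Real.norm_of_nonneg (mul_nonneg (by linarith) (Real.rpow_nonneg hz.1 _))]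
  exact mul_le_mul_of_nonneg_left (Real.rpow_le_rpow hz.1 hz.2 (by linarith)) (by linarith)

lemma exists_rpow_bounds {𝔞 𝔟 : ℝ} (h𝔞 : 0 < 𝔞) (hab : 𝔞 < 𝔟) (e : ℝ) :
    ∃ q R : ℝ, 0 < q ∧ 0 < R ∧ ∀ t ∈ Icc 𝔞 𝔟, q ≤ t ^ e ∧ t ^ e ≤ R := by
  have hc : ContinuousOn (fun t : ℝ => t ^ e) (Icc 𝔞 𝔟) := fun t ht =>
    (Real.continuousAt_rpow_const _ _ (Or.inl (h𝔞.trans_le ht.1).ne')).continuousWithinAt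
  have hne : (Icc 𝔞 𝔟).Nonempty := nonempty_Icc.2 hab.le
  obtain ⟨x, hx, hxm⟩ := isCompact_Icc.exists_isMinOn hne hc
  obtain ⟨y, hy, hym⟩ := isCompact_Icc.exists_isMaxOn hne hc
  exact ⟨x ^ e, y ^ e, Real.rpow_pos_of_pos (h𝔞.trans_le hx.1) _,
    Real.rpow_pos_of_pos (h𝔞.trans_le hy.1) _, fun t ht => ⟨hxm ht, hym ht⟩⟩

lemma exists_lipschitz_radialForce {n lam Lam p a 𝔞 𝔟 T L : ℝ} (hn : 0 ≤ n) (hlam : 0 < lam)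
    (hlL : lam ≤ Lam) (hp : 1 < p) (h𝔞 : 0 < 𝔞) (hab : 𝔞 < 𝔟) (hT : 0 ≤ T) (hL : 0 ≤ L) :
    ∃ K : ℝ, 0 ≤ K ∧ ∀ t ∈ Icc 𝔞 𝔟, ∀ μ ∈ Icc 0 T, ∀ μ' ∈ Icc 0 T, ∀ u ∈ Icc 0 L, ∀ u' ∈ Icc 0 L,
      ∀ v v', |radialForce n lam Lam p a μ t u v - radialForce n lam Lam p a μ' t u' v'| ≤
        K * (|μ - μ'| + |u - u'| + |v - v'|) := by
  obtain ⟨q, R, hq, hR, hqR⟩ := exists_rpow_bounds h𝔞 hab a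
  have hLam : 0 < Lam := hlam.trans_le hlL
  have hLp : 0 ≤ L ^ p := Real.rpow_nonneg hL _
  have hLp' : 0 ≤ L ^ (p - 1) := Real.rpow_nonneg hL _
  have hp0 : 0 < p := by linarith
  set K₁ := n * Lam / 𝔞 with hK₁
  set K₂ := R * L ^ p with hK₂
  set K₃ := T * (R * (p * L ^ (p - 1))) with hK₃
  have h1 : 0 ≤ K₁ := by positivity
  have h2 : 0 ≤ K₂ := by positivity
  have h3 : 0 ≤ K₃ := by positivity
  refine ⟨(K₁ + K₂ + K₃) / lam, by positivity, ?_⟩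
  intro t ht μ hμ μ' hμ' u hu u' hu' v v'
  have ht0 : 0 < t := h𝔞.trans_le ht.1
  refine (abs_Mplus_sub_le hlam hlL _ _).trans ?_
  rw [div_mul_eq_mul_div]
  refine div_le_div_of_nonneg_right ?_ hlam.le
  rw [max_eq_left hu.1, max_eq_left hu'.1]
  have e1 : |n * mplus lam Lam v' / t - n * mplus lam Lam v / t| ≤ K₁ * |v - v'| := by
    rw [← sub_div, ← mul_sub, abs_div, abs_mul, abs_of_nonneg hn, abs_of_pos ht0, hK₁,
      div_mul_eq_mul_div, mul_assoc]
    have := abs_mplus_sub_le hlam hlL v' v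
    rw [abs_sub_comm v' v] at this
    have := ht.1
    gcongr
  have e2 : |(μ - μ') * (t ^ a * u ^ p)| ≤ K₂ * |μ - μ'| := by
    have := Real.rpow_nonneg hu.1 p
    have h5 : 0 < t ^ a := Real.rpow_pos_of_pos ht0 _
    rw [abs_mul, abs_of_nonneg (a := t ^ a * u ^ p) (by positivity), mul_comm, hK₂]
    have := (hqR t ht).2
    have := Real.rpow_le_rpow hu.1 hu.2 hp0.le
    gcongr
  have e3 : |μ' * (t ^ a * (u ^ p - u' ^ p))| ≤ K₃ * |u - u'| := by
    have h5 : 0 < t ^ a := Real.rpow_pos_of_pos ht0 _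
    rw [abs_mul, abs_mul, abs_of_nonneg hμ'.1, abs_of_pos h5, hK₃, mul_assoc, mul_assoc]
    have := (hqR t ht).2
    have := hμ'.2
    have := abs_rpow_sub_rpow_le hp hu hu'
    gcongr
  have e : -(n * mplus lam Lam v) / t - μ * (t ^ a * u ^ p) -
      (-(n * mplus lam Lam v') / t - μ' * (t ^ a * u' ^ p)) =
      (n * mplus lam Lam v' / t - n * mplus lam Lam v / t) - (μ - μ') * (t ^ a * u ^ p) -
        μ' * (t ^ a * (u ^ p - u' ^ p)) := by ring
  rw [e]
  refine (abs_sub _ _).trans ?_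
  refine (add_le_add ((abs_sub _ _).trans (add_le_add e1 e2)) e3).trans ?_
  have := abs_nonneg (μ - μ')
  have := abs_nonneg (u - u')
  have := abs_nonneg (v - v')
  nlinarith [mul_nonneg h1 (abs_nonneg (μ - μ')), mul_nonneg h1 (abs_nonneg (u - u')),
    mul_nonneg h2 (abs_nonneg (u - u')), mul_nonneg h2 (abs_nonneg (v - v')),
    mul_nonneg h3 (abs_nonneg (μ - μ')), mul_nonneg h3 (abs_nonneg (v - v'))]

lemma continuous_radialForce_clamped {n lam Lam p a 𝔞 𝔟 μ u v : ℝ} (hlam : 0 < lam)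
    (hlL : lam ≤ Lam) (h𝔞 : 0 < 𝔞) :
    Continuous fun t => radialForce n lam Lam p a μ (max 𝔞 (min 𝔟 t)) u v := by
  have h : ∀ t, max 𝔞 (min 𝔟 t) ≠ 0 := fun t => (h𝔞.trans_le (le_max_left _ _)).ne'
  have hc : Continuous fun t => max 𝔞 (min 𝔟 t) := by fun_prop
  exact (continuous_Mplus hlam hlL).comp ((continuous_const.div hc h).sub
    (continuous_const.mul ((hc.rpow_const fun t => Or.inl (h t)).mul continuous_const)))

/-- `w`, with derivative `v`, is the solution of the rescaled radial equation with parameter `μ`,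
`w 𝔞 = 0` and `w' 𝔞 = 1`. -/
structure IsShot (n lam Lam p a 𝔞 𝔟 μ : ℝ) (w v : ℝ → ℝ) : Prop where
  left : w 𝔞 = 0
  slope : v 𝔞 = 1
  hasDerivAt : ∀ t ∈ Icc 𝔞 𝔟, HasDerivAt w (v t) t
  hasDerivAt_slope : ∀ t ∈ Icc 𝔞 𝔟, HasDerivAt v (radialForce n lam Lam p a μ t (w t) (v t)) t
  slope_le_one : ∀ t ∈ Icc 𝔞 𝔟, v t ≤ 1
  pos_of_slope_eq_zero : ∀ t ∈ Ioo 𝔞 𝔟, v t = 0 → 0 < μ ∧ 0 < w t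

lemma clamp_mem {lo hi : ℝ} (h : lo ≤ hi) (x : ℝ) : max lo (min hi x) ∈ Icc lo hi :=
  ⟨le_max_left _ _, max_le h (min_le_left _ _)⟩

lemma clamp_eq_self {lo hi x : ℝ} (h : x ∈ Icc lo hi) : max lo (min hi x) = x := by
  rw [min_eq_right h.2, max_eq_right h.1]

lemma abs_clamp_sub_clamp_le (lo hi x y : ℝ) :
    |max lo (min hi x) - max lo (min hi y)| ≤ |x - y| := by
  simpa using (abs_max_sub_max_le_max lo (min hi x) lo (min hi y)).trans
    (max_le_max le_rfl (abs_min_sub_min_le_max hi x hi y))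

/-- The solutions of the truncated first-order system are shots of the untruncated equation. -/
lemma isShot_of_clamped {n lam Lam p a 𝔞 𝔟 μ T R D : ℝ} {K : NNReal} (hn : 0 < n)
    (hlam : 0 < lam) (hlL : lam ≤ Lam) (hp : 1 < p) (h𝔞 : 0 < 𝔞) (hab : 𝔞 < 𝔟) (hμ : μ ∈ Icc 0 T)
    (hR : ∀ t ∈ Icc 𝔞 𝔟, t ^ a ≤ R) (hD0 : 0 < D)
    (hD : T * (R * (𝔟 - 𝔞) ^ p) < n * lam * D / 𝔟) {G : ℝ → ℝ × ℝ × ℝ → ℝ × ℝ × ℝ}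
    (hG : ∀ t ∈ Icc 𝔞 𝔟, ∀ m u v : ℝ, m ∈ Icc 0 T → G t (m, u, v) =
      (0, max (-D) (min 1 v),
        radialForce n lam Lam p a m t (max 0 (min (𝔟 - 𝔞) u)) (max (-D) (min 1 v))))
    (hlip : ∀ t, LipschitzWith K (G t)) {γ : ℝ → ℝ × ℝ × ℝ} (hγ0 : γ 𝔞 = (μ, 0, 1))
    (hγ : ∀ t ∈ Icc 𝔞 𝔟, HasDerivAt γ (G t (γ t)) t) (hG1 : ∀ t x, (G t x).1 = 0) :
    IsShot n lam Lam p a 𝔞 𝔟 μ (fun t => (γ t).2.1) (fun t => (γ t).2.2) := by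
  have hLam : 0 < Lam := hlam.trans_le hlL
  have h𝔟 : 0 < 𝔟 := h𝔞.trans hab
  have hγc : ContinuousOn γ (Icc 𝔞 𝔟) := fun t ht => (hγ t ht).continuousAt.continuousWithinAt
  have hm : ∀ t ∈ Icc 𝔞 𝔟, (γ t).1 = μ := by
    intro t ht
    rw [constant_of_has_deriv_right_zero (f := fun t => (γ t).1) (a := 𝔞) (b := 𝔟)
      hγc.fst (fun x hx => ?_) t ht, hγ0]
    have := ((ContinuousLinearMap.fst ℝ ℝ (ℝ × ℝ)).hasFDerivAt.comp_hasDerivAt x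
      (hγ x (Ico_subset_Icc_self hx))).hasDerivWithinAt (s := Ici x)
    rwa [ContinuousLinearMap.coe_fst', hG1] at this
  set w := fun t => (γ t).2.1 with hw
  set v := fun t => (γ t).2.2 with hv
  have hGγ : ∀ t ∈ Icc 𝔞 𝔟, G t (γ t) = (0, max (-D) (min 1 (v t)),
      radialForce n lam Lam p a μ t (max 0 (min (𝔟 - 𝔞) (w t))) (max (-D) (min 1 (v t)))) := by
    intro t ht
    have e : γ t = (μ, w t, v t) := by rw [← hm t ht]
    conv_lhs => rw [e]
    exact hG t ht _ _ _ hμ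
  have hw' : ∀ t ∈ Icc 𝔞 𝔟, HasDerivAt w (max (-D) (min 1 (v t))) t := by
    intro t ht
    have := ((ContinuousLinearMap.fst ℝ ℝ ℝ).comp
      (ContinuousLinearMap.snd ℝ ℝ (ℝ × ℝ))).hasFDerivAt.comp_hasDerivAt t (hγ t ht)
    rwa [hGγ t ht] at this
  have hv' : ∀ t ∈ Icc 𝔞 𝔟, HasDerivAt v
      (radialForce n lam Lam p a μ t (max 0 (min (𝔟 - 𝔞) (w t))) (max (-D) (min 1 (v t)))) t := by
    intro t ht
    have := ((ContinuousLinearMap.snd ℝ ℝ ℝ).comp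
      (ContinuousLinearMap.snd ℝ ℝ (ℝ × ℝ))).hasFDerivAt.comp_hasDerivAt t (hγ t ht)
    rwa [hGγ t ht] at this
  have hwc : ContinuousOn w (Icc 𝔞 𝔟) := fun t ht => (hw' t ht).continuousAt.continuousWithinAt
  have hvc : ContinuousOn v (Icc 𝔞 𝔟) := fun t ht => (hv' t ht).continuousAt.continuousWithinAt
  have hw𝔞 : w 𝔞 = 0 := by simp [hw, hγ0]
  have hv𝔞 : v 𝔞 = 1 := by simp [hv, hγ0]
  have hforce : ∀ t ∈ Icc 𝔞 𝔟, ∀ u ∈ Icc 0 (𝔟 - 𝔞), 0 ≤ μ * (t ^ a * (max u 0) ^ p) ∧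
      μ * (t ^ a * (max u 0) ^ p) ≤ T * (R * (𝔟 - 𝔞) ^ p) := by
    intro t ht u hu
    rw [max_eq_left hu.1]
    have h1 := Real.rpow_nonneg hu.1 p
    have h2 := Real.rpow_le_rpow hu.1 hu.2 (by linarith : 0 ≤ p)
    have h3 := Real.rpow_nonneg (h𝔞.trans_le ht.1).le a
    have h4 := hR t ht
    have h5 := hμ.1
    have h6 := hμ.2
    have h7 := h5.trans h6
    have h8 := h3.trans h4
    exact ⟨by positivity, by gcongr⟩
  have hcl : ∀ x, max 0 (min (𝔟 - 𝔞) x) ∈ Icc 0 (𝔟 - 𝔞) := clamp_mem (sub_pos.2 hab).le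
  have hv1 : ∀ t ∈ Icc 𝔞 𝔟, v t ≤ 1 := by
    refine image_le_of_deriv_right_lt_deriv_boundary (B := fun _ => 1) (B' := fun _ => 0) hvc
      (fun x hx => (hv' x (Ico_subset_Icc_self hx)).hasDerivWithinAt) hv𝔞.le
      (fun x => hasDerivAt_const x 1) (fun t ht hvt => ?_)
    have ht' := Ico_subset_Icc_self ht
    have ht0 : 0 < t := h𝔞.trans_le ht.1
    rw [hvt, clamp_eq_self ⟨by linarith, le_rfl⟩]
    apply Mplus_neg hlam
    have := (hforce t ht' _ (hcl (w t))).1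
    have : 0 < n * mplus lam Lam 1 / t := by
      rw [mplus, if_neg (by norm_num)]; positivity
    rw [neg_div]
    linarith
  have hvD : ∀ t ∈ Icc 𝔞 𝔟, -v t ≤ D := by
    refine image_le_of_deriv_right_lt_deriv_boundary (B := fun _ => D) (B' := fun _ => 0) hvc.neg
      (fun x hx => (hv' x (Ico_subset_Icc_self hx)).neg.hasDerivWithinAt)
      (by rw [Pi.neg_apply, hv𝔞]; linarith) (fun x => hasDerivAt_const x D) (fun t ht hvt => ?_)
    have ht' := Ico_subset_Icc_self ht
    have ht0 : 0 < t := h𝔞.trans_le ht.1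
    have hvt' : v t = -D := by rw [Pi.neg_apply] at hvt; linarith
    rw [hvt', clamp_eq_self ⟨le_rfl, by linarith⟩, neg_lt_zero]
    apply Mplus_pos hlam hlL
    have h1 := (hforce t ht' _ (hcl (w t))).2
    have h2 : -(n * mplus lam Lam (-D)) / t = n * lam * D / t := by
      rw [mplus, if_pos (by linarith)]; ring
    have h3 : n * lam * D / 𝔟 ≤ n * lam * D / t := by
      have := ht.2.le
      gcongr
    rw [h2]
    linarith
  have hvcl : ∀ t ∈ Icc 𝔞 𝔟, max (-D) (min 1 (v t)) = v t := fun t ht =>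
    clamp_eq_self ⟨by linarith [hvD t ht], hv1 t ht⟩
  have hwL : ∀ t ∈ Icc 𝔞 𝔟, w t ≤ t - 𝔞 := by
    refine image_le_of_deriv_right_le_deriv_boundary (B' := fun _ => 1) hwc
      (fun x hx => (hw' x (Ico_subset_Icc_self hx)).hasDerivWithinAt) (by simp [hw𝔞])
      (by fun_prop) (fun x _ => ((hasDerivAt_id x).sub_const 𝔞).hasDerivWithinAt) (fun x hx => ?_)
    rw [hvcl x (Ico_subset_Icc_self hx)]
    exact hv1 x (Ico_subset_Icc_self hx)
  have hwcl : ∀ t ∈ Icc 𝔞 𝔟, max 0 (min (𝔟 - 𝔞) (w t)) = max (w t) 0 := fun t ht => by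
    rw [min_eq_right (by linarith [hwL t ht, ht.2]), max_comm]
  refine ⟨hw𝔞, hv𝔞, fun t ht => hvcl t ht ▸ hw' t ht, fun t ht => ?_, hv1, fun c hc hvc0 => ?_⟩
  · have := hv' t ht
    rw [hvcl t ht, hwcl t ht] at this
    simpa [radialForce] using this
  · by_contra hcon
    have hsub : Icc 𝔞 c ⊆ Icc 𝔞 𝔟 := Icc_subset_Icc_right hc.2.le
    have key : EqOn γ (fun _ => (μ, w c, 0)) (Icc 𝔞 c) := by
      refine ODE_solution_unique_of_mem_Icc_left (v := G) (s := fun _ => univ) (K := K)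
        (fun t _ => (hlip t).lipschitzOnWith) (hγc.mono hsub)
        (fun t ht => (hγ t (hsub (Ioc_subset_Icc_self ht))).hasDerivWithinAt)
        (fun _ _ => trivial) continuousOn_const (fun t ht => ?_) (fun _ _ => trivial) ?_
      · have hz : G t (μ, w c, 0) = 0 := by
          rw [hG t (hsub (Ioc_subset_Icc_self ht)) _ _ _ hμ,
            clamp_eq_self (x := (0 : ℝ)) ⟨by linarith, zero_le_one⟩,
            radialForce_eq_zero (by linarith)]
          · rfl
          · by_cases h0 : μ = 0
            · exact Or.inl h0
            · refine Or.inr ?_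
              have : w c ≤ 0 := by
                by_contra hwc
                exact hcon ⟨lt_of_le_of_ne hμ.1 (Ne.symm h0), not_le.1 hwc⟩
              exact max_le le_rfl (min_le_of_right_le this)
        rw [hz]
        exact hasDerivWithinAt_const _ _ _
      · have := hm c (Ioo_subset_Icc_self hc)
        show γ c = (μ, w c, 0)
        rw [← this, ← hvc0]
    have := key (left_mem_Icc.2 hc.1.le)
    rw [hγ0] at this
    simp at this

/-- The shots depend continuously on the parameter `μ ∈ [0, T]`. -/
lemma exists_shots {n lam Lam p a 𝔞 𝔟 T : ℝ} (hn : 0 < n) (hlam : 0 < lam) (hlL : lam ≤ Lam)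
    (hp : 1 < p) (h𝔞 : 0 < 𝔞) (hab : 𝔞 < 𝔟) (hT : 0 ≤ T) :
    ∃ w v : ℝ → ℝ → ℝ, ContinuousOn (fun μ => w μ 𝔟) (Icc 0 T) ∧
      ∀ μ ∈ Icc 0 T, IsShot n lam Lam p a 𝔞 𝔟 μ (w μ) (v μ) := by
  obtain ⟨q, R, -, hR0, hqR⟩ := exists_rpow_bounds h𝔞 hab a
  have hL : 0 ≤ 𝔟 - 𝔞 := (sub_pos.2 hab).le
  have h𝔟 : 0 < 𝔟 := h𝔞.trans hab
  have hLp : 0 ≤ (𝔟 - 𝔞) ^ p := Real.rpow_nonneg hL _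
  obtain ⟨K, hK0, hK⟩ := exists_lipschitz_radialForce (n := n) (a := a) hn.le hlam hlL hp h𝔞 hab
    hT hL
  set D := 𝔟 * (T * (R * (𝔟 - 𝔞) ^ p) + 1) / (n * lam) with hDdef
  have hD0 : 0 < D := by positivity
  have hD : T * (R * (𝔟 - 𝔞) ^ p) < n * lam * D / 𝔟 := by
    have : n * lam * D / 𝔟 = T * (R * (𝔟 - 𝔞) ^ p) + 1 := by
      rw [hDdef]; field_simp
    linarith
  set G : ℝ → ℝ × ℝ × ℝ → ℝ × ℝ × ℝ := fun t x => (0, max (-D) (min 1 x.2.2),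
    radialForce n lam Lam p a (max 0 (min T x.1)) (max 𝔞 (min 𝔟 t))
      (max 0 (min (𝔟 - 𝔞) x.2.1)) (max (-D) (min 1 x.2.2))) with hG
  have hlip : ∀ t, LipschitzWith (Real.toNNReal (3 * K + 1)) (G t) := by
    intro t
    refine LipschitzWith.of_dist_le_mul fun x y => ?_
    rw [Real.coe_toNNReal _ (by positivity), dist_eq_norm, dist_eq_norm]
    have h1 : |x.1 - y.1| ≤ ‖x - y‖ := norm_fst_le (x - y)
    have h2 : |x.2.1 - y.2.1| ≤ ‖x - y‖ := (norm_fst_le (x - y).2).trans (norm_snd_le (x - y))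
    have h3 : |x.2.2 - y.2.2| ≤ ‖x - y‖ := (norm_snd_le (x - y).2).trans (norm_snd_le (x - y))
    have h0 := norm_nonneg (x - y)
    have hb : 1 * ‖x - y‖ ≤ (3 * K + 1) * ‖x - y‖ := by gcongr; linarith
    have c1 := abs_clamp_sub_clamp_le 0 T x.1 y.1
    have c2 := abs_clamp_sub_clamp_le 0 (𝔟 - 𝔞) x.2.1 y.2.1
    have c3 := abs_clamp_sub_clamp_le (-D) 1 x.2.2 y.2.2
    refine norm_prod_le_iff.2 ⟨?_, norm_prod_le_iff.2 ⟨?_, ?_⟩⟩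
    · simp only [hG, Prod.fst_sub, sub_self, norm_zero]; positivity
    · exact c3.trans (by linarith)
    · refine (hK _ (clamp_mem hab.le t) _ (clamp_mem hT _) _ (clamp_mem hT _) _ (clamp_mem hL _) _
        (clamp_mem hL _) _ _).trans ?_
      calc _ ≤ K * (‖x - y‖ + ‖x - y‖ + ‖x - y‖) := by gcongr <;> linarith
        _ ≤ _ := by linarith
  have hcont : ∀ x, Continuous (G · x) := fun x =>
    continuous_const.prodMk (continuous_const.prodMk
      (continuous_radialForce_clamped hlam hlL h𝔞))
  have hbound : ∀ t x, ‖G t x‖ ≤ Real.toNNReal ((K + 1) * (T + (𝔟 - 𝔞) + (D + 1))) := by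
    intro t x
    rw [Real.coe_toNNReal _ (by positivity)]
    have c1 := clamp_mem hT x.1
    have c2 := clamp_mem hL x.2.1
    have c3 := clamp_mem (by linarith : -D ≤ 1) x.2.2
    have c3' : |max (-D) (min 1 x.2.2)| ≤ D + 1 := abs_le.2 ⟨by linarith [c3.1], by linarith [c3.2]⟩
    refine norm_prod_le_iff.2 ⟨?_, norm_prod_le_iff.2 ⟨?_, ?_⟩⟩
    · simp only [hG, norm_zero]; positivity
    · refine c3'.trans ?_
      nlinarith
    · have h := hK _ (clamp_mem hab.le t) _ c1 0 ⟨le_rfl, hT⟩ _ c2 0 ⟨le_rfl, hL⟩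
        (max (-D) (min 1 x.2.2)) 0
      rw [radialForce_eq_zero (by linarith) (Or.inl rfl), sub_zero, sub_zero, sub_zero, sub_zero,
        abs_of_nonneg c1.1, abs_of_nonneg c2.1] at h
      refine h.trans ?_
      have : K * (max 0 (min T x.1) + max 0 (min (𝔟 - 𝔞) x.2.1) + |max (-D) (min 1 x.2.2)|) ≤
          K * (T + (𝔟 - 𝔞) + (D + 1)) := by
        have := c1.2
        have := c2.2
        gcongr
      nlinarith
  obtain ⟨α, hα, L', hL'⟩ := exists_flow_of_bounded_of_lipschitz hlip hcont hbound
    (⟨𝔞, by constructor <;> linarith⟩ : Icc (𝔞 - 1) (𝔟 + 1)) (Real.toNNReal (T + 1))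
  have hball : ∀ μ ∈ Icc 0 T, ((μ, 0, 1) : ℝ × ℝ × ℝ) ∈
      Metric.closedBall (0 : ℝ × ℝ × ℝ) (Real.toNNReal (T + 1)) := by
    intro μ hμ
    rw [Real.coe_toNNReal _ (by positivity), mem_closedBall_zero_iff]
    refine norm_prod_le_iff.2 ⟨?_, norm_prod_le_iff.2 ⟨?_, ?_⟩⟩
    · rw [Real.norm_of_nonneg hμ.1]; linarith [hμ.2]
    · simp only [norm_zero]; linarith
    · simp only [norm_one]; linarith
  refine ⟨fun μ t => (α (μ, 0, 1) t).2.1, fun μ t => (α (μ, 0, 1) t).2.2, ?_, fun μ hμ => ?_⟩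
  · have h1 : ContinuousOn (fun μ : ℝ => α (μ, 0, 1) 𝔟) (Icc 0 T) :=
      (hL' 𝔟 ⟨by linarith, by linarith⟩).continuousOn.comp (by fun_prop) hball
    exact h1.snd.fst
  · refine isShot_of_clamped (G := G) hn hlam hlL hp h𝔞 hab hμ (fun t ht => (hqR t ht).2) hD0 hD
      (fun t ht m u v hm => ?_) hlip (hα _ (hball μ hμ)).1 (fun t ht => ?_) (fun _ _ => rfl)
    · simp only [hG, clamp_eq_self hm, clamp_eq_self ht]
    · exact ((hα _ (hball μ hμ)).2 t ⟨by linarith [ht.1], by linarith [ht.2]⟩).hasDerivAt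
        (Icc_mem_nhds (by linarith [ht.1]) (by linarith [ht.2]))

section ConcavityInWeight

variable {w A h h' : ℝ → ℝ} {x y z : ℝ}

lemma exists_sub_eq_mul_sub (hxy : x < y) (hw : ∀ t ∈ Icc x y, HasDerivAt w (A t * h' t) t)
    (hh : ∀ t ∈ Icc x y, HasDerivAt h (h' t) t) (hpos : ∀ t ∈ Icc x y, 0 < h' t) :
    ∃ ξ ∈ Ioo x y, w y - w x = A ξ * (h y - h x) := by
  obtain ⟨ξ, hξ, e⟩ := exists_ratio_hasDerivAt_eq_ratio_slope w (fun t => A t * h' t) hxy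
    (fun t ht => (hw t ht).continuousAt.continuousWithinAt)
    (fun t ht => hw t (Ioo_subset_Icc_self ht)) h h'
    (fun t ht => (hh t ht).continuousAt.continuousWithinAt)
    (fun t ht => hh t (Ioo_subset_Icc_self ht))
  refine ⟨ξ, hξ, mul_right_cancel₀ (hpos ξ (Ioo_subset_Icc_self hξ)).ne' ?_⟩
  rw [← e]; ring

lemma sub_mul_sub_le_sub_mul_sub (hxy : x < y) (hyz : y < z)
    (hw : ∀ t ∈ Icc x z, HasDerivAt w (A t * h' t) t)
    (hh : ∀ t ∈ Icc x z, HasDerivAt h (h' t) t) (hpos : ∀ t ∈ Icc x z, 0 < h' t)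
    (hA : AntitoneOn A (Icc x z)) (hmono : StrictMonoOn h (Icc x z)) :
    (w z - w y) * (h y - h x) ≤ (w y - w x) * (h z - h y) := by
  have h1 : Icc x y ⊆ Icc x z := Icc_subset_Icc_right hyz.le
  have h2 : Icc y z ⊆ Icc x z := Icc_subset_Icc_left hxy.le
  obtain ⟨ξ, hξ, e1⟩ := exists_sub_eq_mul_sub hxy (fun t ht => hw t (h1 ht))
    (fun t ht => hh t (h1 ht)) (fun t ht => hpos t (h1 ht))
  obtain ⟨η, hη, e2⟩ := exists_sub_eq_mul_sub hyz (fun t ht => hw t (h2 ht))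
    (fun t ht => hh t (h2 ht)) (fun t ht => hpos t (h2 ht))
  have hle : A η ≤ A ξ := hA (h1 (Ioo_subset_Icc_self hξ)) (h2 (Ioo_subset_Icc_self hη))
    (hξ.2.trans hη.1).le
  have hx : x ∈ Icc x z := ⟨le_rfl, (hxy.trans hyz).le⟩
  have hy : y ∈ Icc x z := ⟨hxy.le, hyz.le⟩
  have hz : z ∈ Icc x z := ⟨(hxy.trans hyz).le, le_rfl⟩
  have p1 := sub_pos.2 (hmono hx hy hxy)
  have p2 := sub_pos.2 (hmono hy hz hyz)
  rw [e1, e2]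
  nlinarith [mul_le_mul_of_nonneg_right hle (mul_pos p1 p2).le]

end ConcavityInWeight

namespace IsShot

variable {n lam Lam p a 𝔞 𝔟 μ : ℝ} {w v : ℝ → ℝ}

lemma continuousOn (hs : IsShot n lam Lam p a 𝔞 𝔟 μ w v) : ContinuousOn w (Icc 𝔞 𝔟) :=
  fun t ht => (hs.hasDerivAt t ht).continuousAt.continuousWithinAt

lemma continuousOn_slope (hs : IsShot n lam Lam p a 𝔞 𝔟 μ w v) : ContinuousOn v (Icc 𝔞 𝔟) :=
  fun t ht => (hs.hasDerivAt_slope t ht).continuousAt.continuousWithinAt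

lemma pos_of_nonneg_right (hs : IsShot n lam Lam p a 𝔞 𝔟 μ w v) (h𝔟 : 0 ≤ w 𝔟) :
    ∀ t ∈ Ioo 𝔞 𝔟, 0 < w t := by
  intro t ht
  by_contra hwt
  obtain ⟨c, hc, hcm⟩ : ∃ c ∈ Ioo 𝔞 𝔟, IsMinOn w (Icc 𝔞 𝔟) c := by
    obtain ⟨c, hc, hcm⟩ := isCompact_Icc.exists_isMinOn (nonempty_Icc.2 (ht.1.trans ht.2).le)
      hs.continuousOn
    by_cases h : c ∈ Ioo 𝔞 𝔟
    · exact ⟨c, h, hcm⟩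
    · refine ⟨t, ht, fun x hx => ?_⟩
      have hc0 : 0 ≤ w c := by
        rcases hc.1.eq_or_lt with h1 | h1
        · rw [← h1, hs.left]
        · rcases hc.2.eq_or_lt with h2 | h2
          · rwa [h2]
          · exact absurd ⟨h1, h2⟩ h
      exact (not_lt.1 hwt).trans (hc0.trans (hcm hx))
  have hv : v c = 0 := (hcm.isLocalMin (Icc_mem_nhds hc.1 hc.2)).hasDerivAt_eq_zero
    (hs.hasDerivAt c (Ioo_subset_Icc_self hc))
  have h1 : w c ≤ w t := hcm (Ioo_subset_Icc_self ht)
  linarith [(hs.pos_of_slope_eq_zero c hc hv).2]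

lemma pos_right_of_eq_zero (hab : 𝔞 < 𝔟) (hs : IsShot n lam Lam p a 𝔞 𝔟 0 w v) : 0 < w 𝔟 := by
  by_contra hw
  obtain ⟨ξ, hξ, e⟩ := exists_hasDerivAt_eq_slope w v hab hs.continuousOn
    (fun t ht => hs.hasDerivAt t (Ioo_subset_Icc_self ht))
  have hvξ : v ξ ≤ 0 := by
    rw [e, hs.left]
    exact div_nonpos_of_nonpos_of_nonneg (by linarith) (by linarith)
  obtain ⟨c, hc, hvc⟩ := intermediate_value_Icc' hξ.1.le
    (hs.continuousOn_slope.mono (Icc_subset_Icc_right hξ.2.le))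
    (show (0 : ℝ) ∈ Icc (v ξ) (v 𝔞) from ⟨hvξ, by rw [hs.slope]; exact zero_le_one⟩)
  have hc𝔞 : 𝔞 ≠ c := by
    rintro rfl
    rw [hs.slope] at hvc
    exact one_ne_zero hvc
  exact lt_irrefl _
    (hs.pos_of_slope_eq_zero c ⟨lt_of_le_of_ne hc.1 hc𝔞, hc.2.trans_lt hξ.2⟩ hvc).1

lemma le_sub (hs : IsShot n lam Lam p a 𝔞 𝔟 μ w v) : ∀ t ∈ Icc 𝔞 𝔟, w t ≤ t - 𝔞 :=
  image_le_of_deriv_right_le_deriv_boundary (B' := fun _ => 1) hs.continuousOn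
    (fun x hx => (hs.hasDerivAt x (Ico_subset_Icc_self hx)).hasDerivWithinAt) (by simp [hs.left])
    (by fun_prop) (fun x _ => ((hasDerivAt_id x).sub_const 𝔞).hasDerivWithinAt)
    (fun x hx => hs.slope_le_one x (Ico_subset_Icc_self hx))

/-- The flux `tⁿ w'` has derivative at most `-(μ / λ) tⁿ⁺ᵃ wᵖ`. -/
lemma hasDerivAt_flux (hn : 0 < n) (hlam : 0 < lam) (hlL : lam ≤ Lam) (h𝔞 : 0 < 𝔞)
    (hs : IsShot n lam Lam p a 𝔞 𝔟 μ w v) {t : ℝ} (ht : t ∈ Icc 𝔞 𝔟) :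
    ∃ d, HasDerivAt (fun t => t ^ n * v t) d t ∧
      d ≤ -(μ / lam * (t ^ (n + a) * (max (w t) 0) ^ p)) := by
  have ht0 : 0 < t := h𝔞.trans_le ht.1
  refine ⟨_, (Real.hasDerivAt_rpow_const (p := n) (Or.inl ht0.ne')).mul
    (hs.hasDerivAt_slope t ht), ?_⟩
  have htn : 0 < t ^ n := Real.rpow_pos_of_pos ht0 n
  have h1 : radialForce n lam Lam p a μ t (w t) (v t) ≤
      -(n * v t) / t - μ / lam * (t ^ a * (max (w t) 0) ^ p) := by
    refine (Mplus_le_div hlam hlL _).trans ?_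
    have h2 : -(n * mplus lam Lam (v t)) / t ≤ -(n * (lam * v t)) / t := by
      have := mul_le_mplus hlL (v t)
      gcongr
    calc _ ≤ (-(n * (lam * v t)) / t - μ * (t ^ a * max (w t) 0 ^ p)) / lam := by gcongr
      _ = _ := by field_simp
  have h3 := mul_le_mul_of_nonneg_left h1 htn.le
  rw [Real.rpow_sub_one ht0.ne', Real.rpow_add ht0]
  have h4 : t ^ n * (-(n * v t) / t - μ / lam * (t ^ a * (max (w t) 0) ^ p)) =
      -(n * (t ^ n / t) * v t) - μ / lam * (t ^ n * t ^ a * (max (w t) 0) ^ p) := by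
    field_simp
  linarith

end IsShot

lemma hasDerivAt_neg_rpow_one_sub_div {n t : ℝ} (hn : n ≠ 1) (ht : 0 < t) :
    HasDerivAt (fun t : ℝ => -(t ^ (1 - n) / (n - 1))) (t ^ (-n)) t := by
  have h := ((Real.hasDerivAt_rpow_const (p := 1 - n) (Or.inl ht.ne')).div_const (n - 1)).neg
  refine h.congr_deriv ?_
  have : n - 1 ≠ 0 := sub_ne_zero.2 hn
  rw [show (1 - n) - 1 = -n by ring]
  field_simp
  ring

namespace IsShot

variable {n lam Lam p a 𝔞 𝔟 μ : ℝ} {w v : ℝ → ℝ}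

lemma antitoneOn_flux (hn : 0 < n) (hlam : 0 < lam) (hlL : lam ≤ Lam) (h𝔞 : 0 < 𝔞) (hμ : 0 ≤ μ)
    (hs : IsShot n lam Lam p a 𝔞 𝔟 μ w v) : AntitoneOn (fun t => t ^ n * v t) (Icc 𝔞 𝔟) := by
  have hd := fun t (ht : t ∈ Icc 𝔞 𝔟) => hs.hasDerivAt_flux hn hlam hlL h𝔞 ht
  refine antitoneOn_of_deriv_nonpos (convex_Icc _ _) (fun t ht => ?_) (fun t ht => ?_)
    (fun t ht => ?_)
  · obtain ⟨d, h, -⟩ := hd t ht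
    exact h.continuousAt.continuousWithinAt
  · obtain ⟨d, h, -⟩ := hd t (interior_subset ht)
    exact h.differentiableAt.differentiableWithinAt
  · obtain ⟨d, h, hle⟩ := hd t (interior_subset ht)
    rw [h.deriv]
    have ht0 : 0 < t := h𝔞.trans_le (interior_subset ht).1
    exact hle.trans (neg_nonpos.2 (by positivity))

end IsShot

/-- At its maximum, a shot that is nonnegative at the right endpoint is controlled through
`μ wᵖ ≤ C w`. -/
lemma exists_mul_rpow_le_of_isMaxOn {n lam Lam p a 𝔞 𝔟 : ℝ} (hn : 1 < n) (hlam : 0 < lam)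
    (hlL : lam ≤ Lam) (hp : 0 < p) (h𝔞 : 0 < 𝔞) (hab : 𝔞 < 𝔟) :
    ∃ C : ℝ, 0 < C ∧ ∀ μ w v, 0 ≤ μ → IsShot n lam Lam p a 𝔞 𝔟 μ w v → 0 ≤ w 𝔟 →
      ∀ m ∈ Icc 𝔞 𝔟, IsMaxOn w (Icc 𝔞 𝔟) m → μ * w m ^ p ≤ C * w m := by
  obtain ⟨q, _, hq, -, hqR⟩ := exists_rpow_bounds h𝔞 hab (n + a)
  set h : ℝ → ℝ := fun t => -(t ^ (1 - n) / (n - 1)) with hh_def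
  have hh : ∀ t ∈ Icc 𝔞 𝔟, HasDerivAt h (t ^ (-n)) t := fun t ht =>
    hasDerivAt_neg_rpow_one_sub_div hn.ne' (h𝔞.trans_le ht.1)
  have hpos : ∀ t ∈ Icc 𝔞 𝔟, 0 < t ^ (-n) := fun t ht =>
    Real.rpow_pos_of_pos (h𝔞.trans_le ht.1) _
  have hmono : StrictMonoOn h (Icc 𝔞 𝔟) :=
    strictMonoOn_of_deriv_pos (convex_Icc _ _)
      (fun t ht => (hh t ht).continuousAt.continuousWithinAt)
      (fun t ht => by rw [(hh t (interior_subset ht)).deriv]; exact hpos t (interior_subset ht))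
  clear_value h
  obtain ⟨c₁, h1⟩ : ∃ c, c = 𝔞 + (𝔟 - 𝔞) / 3 := ⟨_, rfl⟩
  obtain ⟨c₂, h2⟩ : ∃ c, c = 𝔞 + 2 * (𝔟 - 𝔞) / 3 := ⟨_, rfl⟩
  have hac : 𝔞 < c₁ := by linarith
  have hcc : c₁ < c₂ := by linarith
  have hcb : c₂ < 𝔟 := by linarith
  have m𝔞 : 𝔞 ∈ Icc 𝔞 𝔟 := ⟨le_rfl, hab.le⟩
  have m𝔟 : 𝔟 ∈ Icc 𝔞 𝔟 := ⟨hab.le, le_rfl⟩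
  have m1 : c₁ ∈ Icc 𝔞 𝔟 := ⟨hac.le, (hcc.trans hcb).le⟩
  have m2 : c₂ ∈ Icc 𝔞 𝔟 := ⟨(hac.trans hcc).le, hcb.le⟩
  have d1 : 0 < h c₁ - h 𝔞 := sub_pos.2 (hmono m𝔞 m1 hac)
  have d2 : 0 < h 𝔟 - h c₂ := sub_pos.2 (hmono m2 m𝔟 hcb)
  have dH : 0 < h 𝔟 - h 𝔞 := sub_pos.2 (hmono m𝔞 m𝔟 hab)
  obtain ⟨κ, hκ_def⟩ : ∃ κ, κ = min (h c₁ - h 𝔞) (h 𝔟 - h c₂) / (h 𝔟 - h 𝔞) := ⟨_, rfl⟩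
  have hκ : 0 < κ := hκ_def ▸ div_pos (lt_min d1 d2) dH
  have hκp := Real.rpow_pos_of_pos hκ p
  obtain ⟨B, hB⟩ : ∃ B, B = q * κ ^ p * (c₂ - c₁) / lam := ⟨_, rfl⟩
  have hB0 : 0 < B := by
    have := sub_pos.2 hcc
    rw [hB]; positivity
  refine ⟨(1 / (h c₁ - h 𝔞) + 1 / (h 𝔟 - h c₂)) / B, by positivity, ?_⟩
  intro μ w v hμ hs hw𝔟 m hm hmax
  have hwpos := hs.pos_of_nonneg_right hw𝔟
  set A : ℝ → ℝ := fun t => t ^ n * v t with hA_def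
  have hA : AntitoneOn A (Icc 𝔞 𝔟) := hs.antitoneOn_flux (by linarith) hlam hlL h𝔞 hμ
  have hw : ∀ t ∈ Icc 𝔞 𝔟, HasDerivAt w (A t * t ^ (-n)) t := fun t ht => by
    have ht0 := h𝔞.trans_le ht.1
    refine (hs.hasDerivAt t ht).congr_deriv ?_
    have := (Real.rpow_pos_of_pos ht0 n).ne'
    rw [hA_def, Real.rpow_neg ht0.le]
    field_simp
  have hM : 0 < w m := (hwpos c₁ ⟨hac, hcc.trans hcb⟩).trans_le (hmax m1)
  have hm𝔞 : 𝔞 < m := lt_of_le_of_ne hm.1 fun e => by rw [← e, hs.left] at hM; exact hM.false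
  have hlow : ∀ r ∈ Icc c₁ c₂, κ * w m ≤ w r := by
    intro r hr
    have mr : r ∈ Icc 𝔞 𝔟 := ⟨m1.1.trans hr.1, hr.2.trans m2.2⟩
    have hr0 : 0 < w r := hwpos r ⟨hac.trans_le hr.1, hr.2.trans_lt hcb⟩
    have hr1 : h c₁ ≤ h r := hmono.monotoneOn m1 mr hr.1
    have hr2 : h r ≤ h c₂ := hmono.monotoneOn mr m2 hr.2
    have hm1 : h 𝔞 ≤ h m := hmono.monotoneOn m𝔞 hm hm.1
    have hm2 : h m ≤ h 𝔟 := hmono.monotoneOn hm m𝔟 hm.2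
    rw [hκ_def, div_mul_eq_mul_div, div_le_iff₀ dH]
    rcases lt_trichotomy r m with hlt | rfl | hlt
    · have hsub : Icc 𝔞 m ⊆ Icc 𝔞 𝔟 := Icc_subset_Icc_right hm.2
      have := sub_mul_sub_le_sub_mul_sub (hac.trans_le hr.1) hlt (fun t ht => hw t (hsub ht))
        (fun t ht => hh t (hsub ht)) (fun t ht => hpos t (hsub ht)) (hA.mono hsub)
        (hmono.mono hsub)
      rw [hs.left] at this
      have e1 : min (h c₁ - h 𝔞) (h 𝔟 - h c₂) * w m ≤ (h r - h 𝔞) * w m :=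
        mul_le_mul_of_nonneg_right ((min_le_left _ _).trans (by linarith)) hM.le
      nlinarith [mul_nonneg hr0.le (sub_nonneg.2 hm2)]
    · have e1 : min (h c₁ - h 𝔞) (h 𝔟 - h c₂) ≤ h 𝔟 - h 𝔞 :=
        (min_le_left _ _).trans (by linarith)
      rw [mul_comm]
      gcongr
    · have hsub : Icc m 𝔟 ⊆ Icc 𝔞 𝔟 := Icc_subset_Icc_left hm.1
      have := sub_mul_sub_le_sub_mul_sub hlt (hr.2.trans_lt hcb) (fun t ht => hw t (hsub ht))
        (fun t ht => hh t (hsub ht)) (fun t ht => hpos t (hsub ht)) (hA.mono hsub)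
        (hmono.mono hsub)
      have e1 : min (h c₁ - h 𝔞) (h 𝔟 - h c₂) * w m ≤ (h 𝔟 - h r) * w m :=
        mul_le_mul_of_nonneg_right ((min_le_right _ _).trans (by linarith)) hM.le
      have e2 : h m ≤ h r := hmono.monotoneOn hm mr hlt.le
      nlinarith [mul_nonneg hr0.le (sub_nonneg.2 hm1), mul_nonneg hw𝔟 (sub_nonneg.2 e2)]
  have hdrop : A c₂ - A c₁ ≤ -(μ * w m ^ p * B) := by
    have hd := fun t (ht : t ∈ Icc 𝔞 𝔟) => hs.hasDerivAt_flux (by linarith) hlam hlL h𝔞 ht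
    have hsub : Icc c₁ c₂ ⊆ Icc 𝔞 𝔟 := Icc_subset_Icc m1.1 m2.2
    obtain ⟨ξ, hξ, e⟩ := exists_deriv_eq_slope A hcc
      (fun t ht => by
        obtain ⟨d, hdt, -⟩ := hd t (hsub ht)
        exact hdt.continuousAt.continuousWithinAt)
      (fun t ht => by
        obtain ⟨d, hdt, -⟩ := hd t (hsub (Ioo_subset_Icc_self ht))
        exact hdt.differentiableAt.differentiableWithinAt)
    have hξ' := Ioo_subset_Icc_self hξ
    obtain ⟨d, hdξ, hle⟩ := hd ξ (hsub hξ')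
    rw [hdξ.deriv, eq_div_iff (sub_pos.2 hcc).ne'] at e
    have e1 : (κ * w m) ^ p ≤ (max (w ξ) 0) ^ p :=
      Real.rpow_le_rpow (by positivity) ((hlow ξ hξ').trans (le_max_left _ _)) hp.le
    have e2 : q * (κ * w m) ^ p ≤ ξ ^ (n + a) * (max (w ξ) 0) ^ p :=
      mul_le_mul (hqR ξ (hsub hξ')).1 e1 (by positivity) (hq.le.trans (hqR ξ (hsub hξ')).1)
    have e3 : d ≤ -(μ / lam * (q * (κ * w m) ^ p)) :=
      hle.trans (neg_le_neg (mul_le_mul_of_nonneg_left e2 (by positivity)))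
    rw [← e]
    refine (mul_le_mul_of_nonneg_right e3 (sub_pos.2 hcc).le).trans_eq ?_
    rw [Real.mul_rpow hκ.le hM.le, hB]
    ring
  have hA1 : A c₁ ≤ w m / (h c₁ - h 𝔞) := by
    have hsub : Icc 𝔞 c₁ ⊆ Icc 𝔞 𝔟 := Icc_subset_Icc_right m1.2
    obtain ⟨ξ, hξ, e⟩ := exists_sub_eq_mul_sub hac (fun t ht => hw t (hsub ht))
      (fun t ht => hh t (hsub ht)) (fun t ht => hpos t (hsub ht))
    have := hA (hsub (Ioo_subset_Icc_self hξ)) m1 hξ.2.le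
    rw [hs.left, sub_zero] at e
    rw [le_div_iff₀ d1]
    calc _ ≤ A ξ * (h c₁ - h 𝔞) := by gcongr
      _ ≤ w m := by rw [← e]; exact hmax m1
  have hA2 : -(w m / (h 𝔟 - h c₂)) ≤ A c₂ := by
    have hsub : Icc c₂ 𝔟 ⊆ Icc 𝔞 𝔟 := Icc_subset_Icc_left m2.1
    obtain ⟨ξ, hξ, e⟩ := exists_sub_eq_mul_sub hcb (fun t ht => hw t (hsub ht))
      (fun t ht => hh t (hsub ht)) (fun t ht => hpos t (hsub ht))
    have hle := hA m2 (hsub (Ioo_subset_Icc_self hξ)) hξ.1.le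
    have hwc : w c₂ ≤ w m := hmax m2
    rw [neg_le, le_div_iff₀ d2]
    have := mul_le_mul_of_nonneg_right hle d2.le
    linarith
  rw [div_mul_eq_mul_div, le_div_iff₀ hB0]
  calc μ * w m ^ p * B ≤ w m / (h c₁ - h 𝔞) + w m / (h 𝔟 - h c₂) := by linarith
    _ = _ := by ring

/-- For a large parameter, every shot has reached zero before the right endpoint. -/
lemma exists_forall_isShot_right_nonpos {n lam Lam p a 𝔞 𝔟 : ℝ} (hn : 1 < n) (hlam : 0 < lam)
    (hlL : lam ≤ Lam) (hp : 0 < p) (h𝔞 : 0 < 𝔞) (hab : 𝔞 < 𝔟) :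
    ∃ T : ℝ, 0 < T ∧ ∀ w v, IsShot n lam Lam p a 𝔞 𝔟 T w v → w 𝔟 ≤ 0 := by
  obtain ⟨C, hC, hCM⟩ := exists_mul_rpow_le_of_isMaxOn (a := a) hn hlam hlL hp h𝔞 hab
  obtain ⟨_, R, -, hR, hqR⟩ := exists_rpow_bounds h𝔞 hab a
  have hL : 0 < 𝔟 - 𝔞 := sub_pos.2 hab
  have hLam : 0 < Lam := hlam.trans_le hlL
  obtain ⟨D, hD⟩ : ∃ D, D = (n * Lam / 𝔞 + R * (C * (𝔟 - 𝔞))) / lam := ⟨_, rfl⟩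
  have hD0 : 0 < D := by rw [hD]; positivity
  obtain ⟨σ, hσ⟩ : ∃ σ, σ = min (𝔟 - 𝔞) (1 / (2 * D)) := ⟨_, rfl⟩
  have hσ0 : 0 < σ := hσ ▸ lt_min hL (by positivity)
  have hσL : σ ≤ 𝔟 - 𝔞 := hσ ▸ min_le_left _ _
  have hσD : D * σ ≤ 1 / 2 := by
    have : σ ≤ 1 / (2 * D) := hσ ▸ min_le_right _ _
    calc D * σ ≤ D * (1 / (2 * D)) := by gcongr
      _ = 1 / 2 := by field_simp
  have hσp : 0 < (σ / 2) ^ p := Real.rpow_pos_of_pos (by positivity) p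
  obtain ⟨T, hT⟩ : ∃ T, T = C * (𝔟 - 𝔞) / (σ / 2) ^ p + 1 := ⟨_, rfl⟩
  have hT0 : 0 < T := by rw [hT]; positivity
  refine ⟨T, hT0, fun w v hs => ?_⟩
  by_contra! hw𝔟
  obtain ⟨m, hm, hmax⟩ := isCompact_Icc.exists_isMaxOn (nonempty_Icc.2 hab.le) hs.continuousOn
  have hwm : w m ≤ 𝔟 - 𝔞 := (hs.le_sub m hm).trans (by linarith [hm.2])
  have hbound : T * w m ^ p ≤ C * (𝔟 - 𝔞) :=
    (hCM T w v hT0.le hs hw𝔟.le m hm hmax).trans (by gcongr)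
  have hwm0 : 0 < w m := hw𝔟.trans_le (hmax ⟨hab.le, le_rfl⟩)
  have hforce : ∀ t ∈ Icc 𝔞 𝔟, -D ≤ radialForce n lam Lam p a T t (w t) (v t) := by
    intro t ht
    have ht0 : 0 < t := h𝔞.trans_le ht.1
    have e1 : n * mplus lam Lam (v t) / t ≤ n * Lam / 𝔞 := by
      have h1 : mplus lam Lam (v t) ≤ Lam := by
        have := hs.slope_le_one t ht
        rw [mplus_eq_max hlL]
        exact max_le (by nlinarith) (by nlinarith)
      calc _ ≤ n * Lam / t := by gcongr
        _ ≤ _ := by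
          have := ht.1
          gcongr
    have e2 : T * (t ^ a * (max (w t) 0) ^ p) ≤ R * (C * (𝔟 - 𝔞)) := by
      have h1 : (max (w t) 0) ^ p ≤ w m ^ p :=
        Real.rpow_le_rpow (le_max_right _ _) (max_le (hmax ht) hwm0.le) hp.le
      have h2 := (hqR t ht).2
      calc _ = t ^ a * (T * (max (w t) 0) ^ p) := by ring
        _ ≤ R * (T * w m ^ p) := by gcongr
        _ ≤ _ := by gcongr
    have e3 : Mplus lam Lam (-(D * lam)) = -D := by
      rw [Mplus, if_pos (by nlinarith)]
      field_simp
    rw [← e3]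
    refine Mplus_mono hlam hlL ?_
    have : D * lam = n * Lam / 𝔞 + R * (C * (𝔟 - 𝔞)) := by rw [hD]; field_simp
    rw [neg_div]
    linarith
  have hv : ∀ t ∈ Icc 𝔞 𝔟, 1 - D * (t - 𝔞) ≤ v t := fun t ht =>
    image_le_of_deriv_right_le_deriv_boundary (f := fun t => 1 - D * (t - 𝔞)) (f' := fun _ => -D)
      (by fun_prop)
      (fun x _ => (((((hasDerivAt_id x).sub_const 𝔞).const_mul D).const_sub 1).congr_deriv
        (by ring)).hasDerivWithinAt)
      (by simp [hs.slope]) hs.continuousOn_slope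
      (fun x hx => (hs.hasDerivAt_slope x (Ico_subset_Icc_self hx)).hasDerivWithinAt)
      (fun x hx => hforce x (Ico_subset_Icc_self hx)) ht
  have hsub : Icc 𝔞 (𝔞 + σ) ⊆ Icc 𝔞 𝔟 := Icc_subset_Icc_right (by linarith)
  obtain ⟨ξ, hξ, e⟩ := exists_hasDerivAt_eq_slope w v (by linarith : 𝔞 < 𝔞 + σ)
    (hs.continuousOn.mono hsub) (fun t ht => hs.hasDerivAt t (hsub (Ioo_subset_Icc_self ht)))
  have hvξ : 1 / 2 ≤ v ξ := by
    have := hv ξ (hsub (Ioo_subset_Icc_self hξ))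
    nlinarith [hξ.2]
  have hwσ : σ / 2 ≤ w m := by
    refine le_trans ?_ (hmax (show 𝔞 + σ ∈ Icc 𝔞 𝔟 from ⟨by linarith, by linarith⟩))
    rw [hs.left, eq_div_iff (by linarith)] at e
    nlinarith
  have : T * (σ / 2) ^ p ≤ C * (𝔟 - 𝔞) :=
    le_trans (mul_le_mul_of_nonneg_left (Real.rpow_le_rpow (by positivity) hwσ hp.le) hT0.le) hbound
  rw [hT, add_mul, div_mul_cancel₀ _ hσp.ne'] at this
  linarith

lemma IsShot.contDiffOn {n lam Lam p a 𝔞 𝔟 μ : ℝ} {w v : ℝ → ℝ} (hlam : 0 < lam) (hlL : lam ≤ Lam)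
    (hp : 0 ≤ p) (h𝔞 : 0 < 𝔞) (hab : 𝔞 < 𝔟) (hs : IsShot n lam Lam p a 𝔞 𝔟 μ w v) :
    ContDiffOn ℝ 2 w (Icc 𝔞 𝔟) := by
  have hU := uniqueDiffOn_Icc hab
  have h0 : ∀ t ∈ Icc 𝔞 𝔟, t ≠ 0 := fun t ht => (h𝔞.trans_le ht.1).ne'
  have hv : ContDiffOn ℝ 1 v (Icc 𝔞 𝔟) := by
    refine (contDiffOn_one_iff_derivWithin hU).2
      ⟨fun t ht => (hs.hasDerivAt_slope t ht).differentiableAt.differentiableWithinAt, ?_⟩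
    refine ContinuousOn.congr (f := fun t => radialForce n lam Lam p a μ t (w t) (v t)) ?_
      fun t ht => (hs.hasDerivAt_slope t ht).hasDerivWithinAt.derivWithin (hU t ht)
    refine (continuous_Mplus hlam hlL).comp_continuousOn (ContinuousOn.sub ?_ ?_)
    · exact ((continuousOn_const.mul
        ((continuous_mplus hlL).comp_continuousOn hs.continuousOn_slope)).neg).div continuousOn_id h0
    · refine continuousOn_const.mul ((continuousOn_id.rpow_const fun t ht => Or.inl (h0 t ht)).mul ?_)
      exact (hs.continuousOn.sup continuousOn_const).rpow_const fun t _ => Or.inr hp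
  rw [show (2 : WithTop ℕ∞) = 1 + 1 from one_add_one_eq_two.symm,
    contDiffOn_succ_iff_derivWithin hU]
  exact ⟨fun t ht => (hs.hasDerivAt t ht).differentiableAt.differentiableWithinAt, by simp,
    hv.congr fun t ht => (hs.hasDerivAt t ht).hasDerivWithinAt.derivWithin (hU t ht)⟩

lemma rpow_rescaling {p μ x : ℝ} (hp : 1 < p) (hμ : 0 < μ) (hx : 0 ≤ x) :
    (μ ^ (1 / (p - 1)) * x) ^ p = μ ^ (1 / (p - 1)) * (μ * x ^ p) := by
  have hp' : p - 1 ≠ 0 := by linarith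
  rw [Real.mul_rpow (Real.rpow_nonneg hμ.le _) hx, ← mul_assoc, ← Real.rpow_mul hμ.le,
    ← Real.rpow_add_one hμ.ne']
  congr 2
  field_simp
  ring

/-- Existence of a positive radial solution of `𝓜⁺(D²u) + |x|^a u^p = 0`
vanishing on the boundary of an arbitrary annulus `{𝔞 < |x| < 𝔟}`. -/
theorem annulus_solution_pucci_max
    (N : ℕ) (hN : 3 ≤ N) (lam Lam : ℝ) (hlam : 0 < lam) (hlL : lam ≤ Lam)
    (p a : ℝ) (hp : 1 < p) (ha : -1 < a)
    (hNt : 2 < lam / Lam * ((N : ℝ) - 1) + 1)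
    (𝔞 𝔟 : ℝ) (h𝔞 : 0 < 𝔞) (hab : 𝔞 < 𝔟) :
    ∃ u : ℝ → ℝ, ContDiffOn ℝ 2 u (Icc 𝔞 𝔟) ∧
      (∀ r ∈ Ioo 𝔞 𝔟, 0 < u r) ∧ u 𝔞 = 0 ∧ u 𝔟 = 0 ∧
      ∀ r ∈ Ioo 𝔞 𝔟,
        deriv (deriv u) r =
          Mplus lam Lam
            (-(((N : ℝ) - 1) * mplus lam Lam (deriv u r)) / r - r ^ a * u r ^ p) := by
  have hn : (1 : ℝ) < (N : ℝ) - 1 := by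
    have : (3 : ℝ) ≤ N := by exact_mod_cast hN
    linarith
  have hp0 : 0 < p := by linarith
  obtain ⟨T, hT, hT𝔟⟩ := exists_forall_isShot_right_nonpos (a := a) hn hlam hlL hp0 h𝔞 hab
  obtain ⟨w, v, hcont, hshot⟩ :=
    exists_shots (a := a) (by linarith : 0 < (N : ℝ) - 1) hlam hlL hp h𝔞 hab hT.le
  have h0 : 0 < w 0 𝔟 := (hshot 0 ⟨le_rfl, hT.le⟩).pos_right_of_eq_zero hab
  obtain ⟨μ, hμ, hw𝔟⟩ := intermediate_value_Icc' hT.le hcont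
    ⟨hT𝔟 _ _ (hshot T ⟨hT.le, le_rfl⟩), h0.le⟩
  have hμ0 : 0 < μ := lt_of_le_of_ne hμ.1 (by rintro rfl; exact h0.ne' hw𝔟)
  have hs := hshot μ hμ
  have hwpos := hs.pos_of_nonneg_right hw𝔟.ge
  set δ := μ ^ (1 / (p - 1)) with hδ
  have hδ0 : 0 < δ := Real.rpow_pos_of_pos hμ0 _
  have hderiv : ∀ t ∈ Icc 𝔞 𝔟, deriv (fun t => δ * w μ t) t = δ * v μ t := fun t ht =>
    ((hs.hasDerivAt t ht).const_mul δ).deriv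
  refine ⟨fun t => δ * w μ t, contDiffOn_const.mul (hs.contDiffOn hlam hlL hp0.le h𝔞 hab),
    fun r hr => mul_pos hδ0 (hwpos r hr), by simp [hs.left], mul_eq_zero_of_right _ hw𝔟,
    fun r hr => ?_⟩
  have hr' := Ioo_subset_Icc_self hr
  have hev : deriv (fun t => δ * w μ t) =ᶠ[nhds r] fun t => δ * v μ t := by
    filter_upwards [Icc_mem_nhds hr.1 hr.2] with t ht using hderiv t ht
  rw [hev.deriv_eq, ((hs.hasDerivAt_slope r hr').const_mul δ).deriv, hderiv r hr',
    mplus_mul_of_pos hδ0, hδ, rpow_rescaling hp hμ0 (hwpos r hr).le, ← hδ, radialForce,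
    max_eq_left (hwpos r hr).le, ← Mplus_mul_of_pos hδ0]
  congr 1
  ring
end

section
/- Let F = (f,g) be the (DS⁺) vector field, f(x,z) = x(x+1) − M₊(λ(N−1)x − z) and g(x,z) = z(x+2+a−px), and let π₁⁺ be the parabola z = Λ(Ñ₊−2)x − Λx². For every 0 < x < Ñ₊−2, the point Q = (x, Λ(Ñ₊−2)x − Λx²) satisfies 0 < Λ(Ñ₊−2)x − Λx² < λ(N−1)x (so π₁⁺ lies strictly below the concavity line ℓ₊ = {z = λ(N−1)x}, inside the convexity region R⁻_λ), f(Q) = 0, and, with α = (2+a)/(p−1): g(Q) > 0 if x < α, g(Q) = 0 if x = α, and g(Q) < 0 if x > α. Thus on π₁⁺ the vector field is parallel to the z-axis, pointing up for x < α and down for x > α. -/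
open Real Set

/-- Behavior of the (DS⁺) vector field on the parabola `π₁⁺`: for `0 < x < Ñ₊-2`
the point `Q = (x, Λ(Ñ₊-2)x - Λx²)` lies strictly between the `x`-axis and the
concavity line `ℓ₊`, `f(Q) = 0`, and `g(Q)` is positive for `x < α`, zero at
`x = α`, negative for `x > α`. -/
theorem flow_on_parabola
    (N : ℕ) (hN : 3 ≤ N) (lam Lam : ℝ) (hlam : 0 < lam) (hlL : lam ≤ Lam)
    (p a : ℝ) (hp : 1 < p) (ha : -1 < a)
    (Nt : ℝ) (hNtdef : Nt = lam / Lam * ((N : ℝ) - 1) + 1) (hNt : 2 < Nt)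
    (α : ℝ) (hα : α = (2 + a) / (p - 1))
    (f g : ℝ → ℝ → ℝ)
    (hf : ∀ x z, f x z = x * (x + 1) - Mplus lam Lam (lam * ((N : ℝ) - 1) * x - z))
    (hg : ∀ x z, g x z = z * (x + 2 + a - p * x)) :
    ∀ x : ℝ, 0 < x → x < Nt - 2 →
      0 < Lam * (Nt - 2) * x - Lam * x ^ 2 ∧
      Lam * (Nt - 2) * x - Lam * x ^ 2 < lam * ((N : ℝ) - 1) * x ∧
      f x (Lam * (Nt - 2) * x - Lam * x ^ 2) = 0 ∧
      (x < α → 0 < g x (Lam * (Nt - 2) * x - Lam * x ^ 2)) ∧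
      (x = α → g x (Lam * (Nt - 2) * x - Lam * x ^ 2) = 0) ∧
      (α < x → g x (Lam * (Nt - 2) * x - Lam * x ^ 2) < 0) := by
  intro x hx hxN
  have hLam : 0 < Lam := hlam.trans_le hlL
  have hline : lam * ((N : ℝ) - 1) = Lam * (Nt - 1) := by
    rw [hNtdef]
    field_simp
    ring
  have hp1 : 0 < p - 1 := sub_pos.mpr hp
  have hgap : lam * ((N : ℝ) - 1) * x - (Lam * (Nt - 2) * x - Lam * x ^ 2)
      = Lam * (x * (x + 1)) := by
    rw [hline]
    ring
  have hgap_pos : 0 < Lam * (x * (x + 1)) := by positivity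
  have hz : 0 < Lam * (Nt - 2) * x - Lam * x ^ 2 := by
    have h : 0 < Lam * x * (Nt - 2 - x) := mul_pos (mul_pos hLam hx) (sub_pos.mpr hxN)
    linarith
  have hfactor : x + 2 + a - p * x = (p - 1) * (α - x) := by
    rw [hα]
    field_simp
    ring
  refine ⟨hz, by linarith, ?_, fun h => ?_, fun h => ?_, fun h => ?_⟩
  · rw [hf, hgap, Mplus, if_neg hgap_pos.not_ge, mul_div_cancel_left₀ _ hLam.ne', sub_self]
  · rw [hg, hfactor]
    exact mul_pos hz (mul_pos hp1 (sub_pos.mpr h))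
  · rw [hg, hfactor, h, sub_self, mul_zero, mul_zero]
  · rw [hg, hfactor]
    exact mul_neg_of_pos_of_neg hz (mul_neg_of_pos_of_neg hp1 (sub_neg.mpr h))
end

section
/- Let G(x,z) = ( x(x−(Ñ₊−2)) + z/Λ, z(p−1)(α−x) ) be the smooth branch of the (DS⁺) vector field valid on the convexity region {0 ≤ z < λ(N−1)x}. The Jacobian matrix of G at the stationary point A₀ = (Ñ₊−2, 0) is upper triangular with eigenvalues σ₁ = Ñ₊−2 > 0 and σ₂ = (p−1)(α−(Ñ₊−2)); one has σ₂ < 0 if and only if p > p^{s,a}₊ = (Ñ₊+a)/(Ñ₊−2), σ₂ = 0 iff p = p^{s,a}₊, and σ₂ > 0 iff p < p^{s,a}₊. Moreover, when p > p^{s,a}₊, the eigendirection of σ₂ is the line z = −A₊·(x − (Ñ₊−2)) through A₀, where A₊ = Λ[(Ñ₊−2)p − (2+a)]; hence A₀ is a hyperbolic saddle point for p > p^{s,a}₊. -/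
open Real Set

/-- The derivative of the planar field `(x (x - m) + z / L, z c (b - x))` at its zero `(m, 0)`. -/
theorem fderiv_planarField_apply (m L c b : ℝ) (G : ℝ × ℝ → ℝ × ℝ)
    (hG : ∀ q : ℝ × ℝ, G q = (q.1 * (q.1 - m) + q.2 / L, q.2 * c * (b - q.1))) (v : ℝ × ℝ) :
    fderiv ℝ G (m, 0) v = (m * v.1 + v.2 / L, c * (b - m) * v.2) := by
  have h₁ : HasFDerivAt (fun q : ℝ × ℝ => q.1) (ContinuousLinearMap.fst ℝ ℝ ℝ) (m, 0) :=
    hasFDerivAt_fst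
  have h₂ : HasFDerivAt (fun q : ℝ × ℝ => q.2) (ContinuousLinearMap.snd ℝ ℝ ℝ) (m, 0) :=
    hasFDerivAt_snd
  have h := ((h₁.mul (h₁.sub_const m)).add (h₂.mul_const L⁻¹)).prodMk
    ((h₂.mul_const c).mul (h₁.const_sub b))
  have hG' : HasFDerivAt G _ (m, 0) :=
    h.congr_of_eventuallyEq (.of_forall fun q => by simp [hG, div_eq_mul_inv])
  rw [hG'.fderiv]
  ext <;> simp <;> ring

/-- Linearization of the smooth branch `G` of (DS⁺) at `A₀ = (Ñ₊-2, 0)`: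
the Jacobian is upper triangular with eigenvalues `σ₁ = Ñ₊-2 > 0` and
`σ₂ = (p-1)(α-(Ñ₊-2))`, whose sign is determined by the comparison of `p` with
`p^{s,a}₊ = (Ñ₊+a)/(Ñ₊-2)`; for `p > p^{s,a}₊` the stable eigendirection is the
line `z = -A₊(x-(Ñ₊-2))` with `A₊ = Λ[(Ñ₊-2)p-(2+a)]`, so `A₀` is a saddle. -/
theorem saddle_A0
    (N : ℕ) (hN : 3 ≤ N) (lam Lam : ℝ) (hlam : 0 < lam) (hlL : lam ≤ Lam)
    (p a : ℝ) (hp : 1 < p) (ha : -1 < a)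
    (Nt : ℝ) (hNtdef : Nt = lam / Lam * ((N : ℝ) - 1) + 1) (hNt : 2 < Nt)
    (α : ℝ) (hα : α = (2 + a) / (p - 1))
    (G : ℝ × ℝ → ℝ × ℝ)
    (hG : ∀ q : ℝ × ℝ,
      G q = (q.1 * (q.1 - (Nt - 2)) + q.2 / Lam, q.2 * (p - 1) * (α - q.1)))
    (σ₁ σ₂ Aplus : ℝ)
    (hσ₁ : σ₁ = Nt - 2) (hσ₂ : σ₂ = (p - 1) * (α - (Nt - 2)))
    (hA : Aplus = Lam * ((Nt - 2) * p - (2 + a))) :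
    fderiv ℝ G (Nt - 2, 0) (1, 0) = (σ₁, 0) ∧
    fderiv ℝ G (Nt - 2, 0) (0, 1) = (1 / Lam, σ₂) ∧
    0 < σ₁ ∧
    (σ₂ < 0 ↔ (Nt + a) / (Nt - 2) < p) ∧
    (σ₂ = 0 ↔ p = (Nt + a) / (Nt - 2)) ∧
    (0 < σ₂ ↔ p < (Nt + a) / (Nt - 2)) ∧
    ((Nt + a) / (Nt - 2) < p →
      fderiv ℝ G (Nt - 2, 0) (1, -Aplus) = σ₂ • ((1 : ℝ), -Aplus) ∧
      σ₂ < 0 ∧ 0 < σ₁) := by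
  have hm : 0 < Nt - 2 := sub_pos.mpr hNt
  have hL : Lam ≠ 0 := (hlam.trans_le hlL).ne'
  have hp' : p - 1 ≠ 0 := (sub_pos.mpr hp).ne'
  have hD := fderiv_planarField_apply (Nt - 2) Lam (p - 1) α G hG
  have hσ : σ₂ = Nt + a - p * (Nt - 2) := by
    rw [hσ₂, hα, mul_sub, mul_div_cancel₀ _ hp']
    ring
  have hneg : σ₂ < 0 ↔ (Nt + a) / (Nt - 2) < p := by
    rw [div_lt_iff₀ hm, hσ, sub_neg]
  refine ⟨?_, ?_, hσ₁ ▸ hm, hneg, ?_, ?_, fun h => ⟨?_, hneg.mpr h, hσ₁ ▸ hm⟩⟩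
  · simp [hD, hσ₁]
  · simp [hD, hσ₂]
  · rw [eq_div_iff hm.ne', hσ, sub_eq_zero, eq_comm]
  · rw [lt_div_iff₀ hm, hσ, sub_pos]
  · rw [hD, ← hσ₂]
    ext
    · simp only [Prod.smul_fst, smul_eq_mul, mul_one, hσ, hA, neg_div]
      rw [mul_div_cancel_left₀ _ hL]
      ring
    · simp
end

section
/- Assume p > p^{s,a}₊ = (Ñ₊+a)/(Ñ₊−2), set α = (2+a)/(p−1), z₀ = Λα(Ñ₊−2−α) and M₀ = (α, z₀). Then 0 < z₀ < λ(N−1)α, so M₀ lies in the open convexity region {0 < z < λ(N−1)x}, and M₀ is a stationary point of the smooth branch G(x,z) = ( x(x−(Ñ₊−2)) + z/Λ, z(p−1)(α−x) ) of (DS⁺). The Jacobian of G at M₀ equals [[2α−(Ñ₊−2), 1/Λ], [−(p−1)z₀, 0]]; its determinant (p−1)z₀/Λ is positive, and its trace 2α−(Ñ₊−2) is positive iff p < p^{p,a}₊ = (Ñ₊+2a+2)/(Ñ₊−2), zero iff p = p^{p,a}₊, and negative iff p > p^{p,a}₊. Consequently both eigenvalues of the Jacobian have positive real part (M₀ is a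 source) for p^{s,a}₊ < p < p^{p,a}₊, both have negative real part (M₀ is a sink) for p > p^{p,a}₊, and the eigenvalues are purely imaginary at p = p^{p,a}₊. -/
open Real Set

/-- A complex root `μ` of the real quadratic `μ² - Tμ + D` is either real, and then
`T * re μ = (re μ)² + D`, or has real part `T / 2`. -/
lemma re_root_of_quadratic {T D : ℝ} {μ : ℂ}
    (h : μ ^ 2 - (T : ℂ) * μ + (D : ℂ) = 0) :
    T * μ.re = μ.re ^ 2 + D ∨ μ.re = T / 2 := by
  have hre := congrArg Complex.re h
  have him := congrArg Complex.im h
  simp only [pow_two, Complex.add_re, Complex.sub_re, Complex.mul_re, Complex.ofReal_re,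
    Complex.ofReal_im, Complex.zero_re, Complex.add_im, Complex.sub_im, Complex.mul_im,
    Complex.zero_im] at hre him
  have hfac : μ.im * (2 * μ.re - T) = 0 := by linarith
  rcases mul_eq_zero.mp hfac with hy | hx
  · left
    rw [hy] at hre
    linarith
  · right
    linarith

/-- Derivative of the planar quadratic field `(x (x - c) + z / L, z k (α - x))`. -/
lemma fderiv_planar_quadratic_apply (c L k α : ℝ) (q v : ℝ × ℝ) :
    fderiv ℝ (fun q : ℝ × ℝ => (q.1 * (q.1 - c) + q.2 / L, q.2 * k * (α - q.1))) q v =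
      ((2 * q.1 - c) * v.1 + v.2 / L, k * (α - q.1) * v.2 - k * q.2 * v.1) := by
  have h₁ : HasFDerivAt (fun q : ℝ × ℝ => q.1) (ContinuousLinearMap.fst ℝ ℝ ℝ) q := hasFDerivAt_fst
  have h₂ : HasFDerivAt (fun q : ℝ × ℝ => q.2) (ContinuousLinearMap.snd ℝ ℝ ℝ) q := hasFDerivAt_snd
  have h := ((h₁.mul (h₁.sub_const c)).add (h₂.mul_const L⁻¹)).prodMk
    ((h₂.mul_const k).mul (h₁.const_sub α))
  simp only [div_eq_mul_inv]
  refine (congrArg (fun A : ℝ × ℝ →L[ℝ] ℝ × ℝ => A v) h.fderiv).trans ?_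
  ext <;> simp <;> ring

/-- Linearization of the smooth branch `G` of (DS⁺) at `M₀ = (α, z₀)`,
`z₀ = Λα(Ñ₊-2-α)`: `M₀` lies in the open convexity region, is stationary, the
Jacobian is `[[2α-(Ñ₊-2), 1/Λ], [-(p-1)z₀, 0]]` with positive determinant
`(p-1)z₀/Λ`, its trace `2α-(Ñ₊-2)` changes sign at `p^{p,a}₊ = (Ñ₊+2a+2)/(Ñ₊-2)`,
and consequently the eigenvalues (roots of `μ² - Tμ + D = 0`) have positive real
part for `p^{s,a}₊ < p < p^{p,a}₊` (source), negative real part for `p > p^{p,a}₊`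
(sink), and are purely imaginary at `p = p^{p,a}₊`. -/
theorem nature_M0
    (N : ℕ) (hN : 3 ≤ N) (lam Lam : ℝ) (hlam : 0 < lam) (hlL : lam ≤ Lam)
    (p a : ℝ) (hp : 1 < p) (ha : -1 < a)
    (Nt : ℝ) (hNtdef : Nt = lam / Lam * ((N : ℝ) - 1) + 1) (hNt : 2 < Nt)
    (hpsa : (Nt + a) / (Nt - 2) < p)
    (α : ℝ) (hα : α = (2 + a) / (p - 1))
    (z₀ : ℝ) (hz₀ : z₀ = Lam * α * (Nt - 2 - α))
    (G : ℝ × ℝ → ℝ × ℝ)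
    (hG : ∀ q : ℝ × ℝ,
      G q = (q.1 * (q.1 - (Nt - 2)) + q.2 / Lam, q.2 * (p - 1) * (α - q.1)))
    (T D : ℝ) (hT : T = 2 * α - (Nt - 2)) (hD : D = (p - 1) * z₀ / Lam) :
    0 < z₀ ∧ z₀ < lam * ((N : ℝ) - 1) * α ∧
    G (α, z₀) = (0, 0) ∧
    fderiv ℝ G (α, z₀) (1, 0) = (T, -((p - 1) * z₀)) ∧
    fderiv ℝ G (α, z₀) (0, 1) = (1 / Lam, 0) ∧
    0 < D ∧
    (0 < T ↔ p < (Nt + 2 * a + 2) / (Nt - 2)) ∧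
    (T = 0 ↔ p = (Nt + 2 * a + 2) / (Nt - 2)) ∧
    (T < 0 ↔ (Nt + 2 * a + 2) / (Nt - 2) < p) ∧
    (∀ μ : ℂ, μ ^ 2 - (T : ℂ) * μ + (D : ℂ) = 0 →
      (p < (Nt + 2 * a + 2) / (Nt - 2) → 0 < μ.re) ∧
      ((Nt + 2 * a + 2) / (Nt - 2) < p → μ.re < 0) ∧
      (p = (Nt + 2 * a + 2) / (Nt - 2) → μ.re = 0)) := by
  have hLam : 0 < Lam := hlam.trans_le hlL
  have hp' : 0 < p - 1 := sub_pos.mpr hp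
  have hc : 0 < Nt - 2 := sub_pos.mpr hNt
  have hα_pos : 0 < α := hα ▸ div_pos (by linarith) hp'
  have hα_mul : α * (p - 1) = 2 + a := by rw [hα, div_mul_cancel₀ _ hp'.ne']
  have hα_lt : α < Nt - 2 := by
    rw [hα, div_lt_iff₀ hp']
    rw [div_lt_iff₀ hc] at hpsa
    linarith
  have hz_pos : 0 < z₀ := hz₀ ▸ mul_pos (mul_pos hLam hα_pos) (sub_pos.mpr hα_lt)
  have hNt_mul : lam * ((N : ℝ) - 1) = Lam * (Nt - 1) := by
    rw [hNtdef]
    field_simp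
    ring
  have hD_pos : 0 < D := hD ▸ div_pos (mul_pos hp' hz_pos) hLam
  have hT_mul : T * (p - 1) = Nt + 2 * a + 2 - p * (Nt - 2) := by
    rw [hT]
    linarith
  have hT_pos : 0 < T ↔ p < (Nt + 2 * a + 2) / (Nt - 2) := by
    rw [lt_div_iff₀ hc, ← mul_pos_iff_of_pos_right hp', hT_mul, sub_pos]
  have hT_zero : T = 0 ↔ p = (Nt + 2 * a + 2) / (Nt - 2) := by
    rw [eq_div_iff hc.ne', ← mul_eq_zero_iff_right hp'.ne', hT_mul, sub_eq_zero, eq_comm]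
  have hT_neg : T < 0 ↔ (Nt + 2 * a + 2) / (Nt - 2) < p := by
    rw [div_lt_iff₀ hc, ← neg_pos, ← mul_pos_iff_of_pos_right hp', neg_mul, hT_mul, neg_sub,
      sub_pos]
  obtain rfl : G = fun q => (q.1 * (q.1 - (Nt - 2)) + q.2 / Lam, q.2 * (p - 1) * (α - q.1)) :=
    funext hG
  refine ⟨hz_pos, ?_, ?_, ?_, ?_, hD_pos, hT_pos, hT_zero, hT_neg, fun μ hμ => ?_⟩
  · rw [hNt_mul, hz₀]
    nlinarith [mul_pos hLam hα_pos]
  · simp only [hz₀, sub_self, mul_zero, Prod.mk.injEq, and_true]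
    field_simp
    ring
  · rw [fderiv_planar_quadratic_apply, hT]
    simp
  · rw [fderiv_planar_quadratic_apply]
    simp
  · rw [← hT_pos, ← hT_neg, ← hT_zero]
    rcases re_root_of_quadratic hμ with h | h
    · have hmul : 0 < T * μ.re := h ▸ by positivity
      refine ⟨fun hT => (mul_pos_iff_of_pos_left hT).mp hmul,
        fun hT => neg_of_mul_pos_right hmul hT.le, fun hT => ?_⟩
      simp [hT] at hmul
    · exact ⟨fun hT => by linarith, fun hT => by linarith, fun hT => by linarith⟩
end

section
/- Let t₀ ∈ ℝ and let (x,z) : (s, t₀] → ℝ² be a C¹ solution of the second-quadrant system x'(t) = x(t)(x(t) − Ñ₋ + 2) + z(t)/λ, z'(t) = z(t)(x(t) + 2 + a − p·x(t)) with x(t) < 0 and z(t) > 0 for all t ∈ (s, t₀]. Then x'(t) > 0 and z'(t) > 0 for all t ∈ (s, t₀]. Moreover, setting c₀ = 1 − (Ñ₋−2)/x(t₀) > 1, one has x(t) ≤ −(Ñ₋−2)/( c₀·e^{(Ñ₋−2)(t−t₀)} − 1 ) for all t ∈ (s, t₀]; in particular s ≥ t₁ := t₀ − ln(c₀)/(Ñ₋−2),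 so x blows up to −∞ in finite backward time. -/
open Real Set

/-- If `m > 0` and `x < 0` satisfies `x' ≥ x (x - m)` on `(s, t₀]`, then
`t ↦ (1 - m / x t) * exp (-m (t - t₀))` is monotone there. -/
theorem monotoneOn_one_sub_div_mul_exp {m s t₀ : ℝ} (hm : 0 < m) {x x' : ℝ → ℝ}
    (hx : ∀ t ∈ Ioc s t₀, HasDerivAt x (x' t) t) (hneg : ∀ t ∈ Ioc s t₀, x t < 0)
    (hx' : ∀ t ∈ Ioc s t₀, x t * (x t - m) ≤ x' t) :
    MonotoneOn (fun t => (1 - m / x t) * Real.exp (-m * (t - t₀))) (Ioc s t₀) := by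
  have hd : ∀ t ∈ Ioc s t₀, HasDerivAt (fun t => (1 - m / x t) * Real.exp (-m * (t - t₀)))
      (m / x t ^ 2 * (x' t - x t * (x t - m)) * Real.exp (-m * (t - t₀))) t := by
    intro t ht
    have hxt : x t ≠ 0 := (hneg t ht).ne
    have hw := (((hasDerivAt_const t m).div (hx t ht) hxt).const_sub 1).mul
      (((hasDerivAt_id t).sub_const t₀).const_mul (-m)).exp
    refine HasDerivAt.congr_deriv hw ?_
    simp only [id_eq, Pi.div_apply]
    field_simp
    ring
  refine monotoneOn_of_hasDerivWithinAt_nonneg (convex_Ioc s t₀)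
    (fun t ht => (hd t ht).continuousAt.continuousWithinAt)
    (fun t ht => (hd t (interior_subset ht)).hasDerivWithinAt) fun t ht => ?_
  have := sub_nonneg.2 (hx' t (interior_subset ht))
  positivity

/-- In the second quadrant `{x < 0, z > 0}` the flow moves up and to the right,
and `x` blows up to `-∞` in finite backward time: the solution satisfies the
explicit lower barrier and cannot extend below `t₁ = t₀ - ln(c₀)/(Ñ₋-2)`. -/
theorem second_quadrant_backward_blowup
    (N : ℕ) (hN : 3 ≤ N) (lam Lam : ℝ) (hlam : 0 < lam) (hlL : lam ≤ Lam)
    (p a : ℝ) (hp : 1 < p) (ha : -1 < a)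
    (Nm : ℝ) (hNm : Nm = Lam / lam * ((N : ℝ) - 1) + 1)
    (s t₀ : ℝ) (hst : s < t₀)
    (x z : ℝ → ℝ)
    (hx : ContDiffOn ℝ 1 x (Ioc s t₀)) (hz : ContDiffOn ℝ 1 z (Ioc s t₀))
    (hdx : ∀ t ∈ Ioc s t₀,
      HasDerivAt x (x t * (x t - (Nm - 2)) + z t / lam) t)
    (hdz : ∀ t ∈ Ioc s t₀,
      HasDerivAt z (z t * (x t + 2 + a - p * x t)) t)
    (hxneg : ∀ t ∈ Ioc s t₀, x t < 0) (hzpos : ∀ t ∈ Ioc s t₀, 0 < z t)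
    (c₀ : ℝ) (hc₀ : c₀ = 1 - (Nm - 2) / x t₀) :
    (∀ t ∈ Ioc s t₀,
      0 < x t * (x t - (Nm - 2)) + z t / lam ∧
      0 < z t * (x t + 2 + a - p * x t)) ∧
    1 < c₀ ∧
    (∀ t ∈ Ioc s t₀,
      x t ≤ -(Nm - 2) / (c₀ * Real.exp ((Nm - 2) * (t - t₀)) - 1)) ∧
    t₀ - Real.log c₀ / (Nm - 2) ≤ s := by
  have hm : 0 < Nm - 2 := by
    have h1 : 1 ≤ Lam / lam := (one_le_div hlam).2 hlL
    have h2 : (3 : ℝ) ≤ N := by exact_mod_cast hN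
    nlinarith
  have ht₀ : t₀ ∈ Ioc s t₀ := ⟨hst, le_rfl⟩
  have one_lt : ∀ t ∈ Ioc s t₀, 1 < 1 - (Nm - 2) / x t := fun t ht => by
    linarith [div_neg_of_pos_of_neg hm (hxneg t ht)]
  have hc : 1 < c₀ := hc₀ ▸ one_lt t₀ ht₀
  have hmono := monotoneOn_one_sub_div_mul_exp hm hdx hxneg fun t ht => by
    linarith [div_pos (hzpos t ht) hlam]
  have barrier : ∀ t ∈ Ioc s t₀,
      1 - (Nm - 2) / x t ≤ c₀ * Real.exp ((Nm - 2) * (t - t₀)) := by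
    intro t ht
    have h : (1 - (Nm - 2) / x t) * Real.exp (-(Nm - 2) * (t - t₀)) ≤ c₀ := by
      simpa [← hc₀] using hmono ht ht₀ ht.2
    rwa [neg_mul, Real.exp_neg, ← div_eq_mul_inv, div_le_iff₀ (Real.exp_pos _)] at h
  refine ⟨fun t ht => ⟨?_, ?_⟩, hc, fun t ht => ?_, ?_⟩
  · have hxt := hxneg t ht
    exact add_pos (mul_pos_of_neg_of_neg hxt (by linarith)) (div_pos (hzpos t ht) hlam)
  · have hxt := hxneg t ht
    exact mul_pos (hzpos t ht) (by nlinarith)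
  · have hD : 0 < c₀ * Real.exp ((Nm - 2) * (t - t₀)) - 1 := by
      linarith [barrier t ht, one_lt t ht]
    have hb : (Nm - 2) / -x t ≤ c₀ * Real.exp ((Nm - 2) * (t - t₀)) - 1 := by
      rw [div_neg]
      linarith [barrier t ht]
    rw [div_le_iff₀ (neg_pos.2 (hxneg t ht))] at hb
    rw [le_div_iff₀ hD]
    linarith
  · refine le_of_forall_gt_imp_ge_of_dense fun t ht => ?_
    rcases le_total t t₀ with h | h
    · have h1 := (one_lt t ⟨ht, h⟩).trans_le (barrier t ⟨ht, h⟩)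
      have h2 := Real.log_pos h1
      rw [Real.log_mul (by positivity) (Real.exp_ne_zero _), Real.log_exp] at h2
      rw [sub_le_comm, le_div_iff₀ hm]
      linarith
    · linarith [div_pos (Real.log_pos hc) hm]
end

section
/- Let t̂ ∈ ℝ and let (x,z) : (−∞, t̂] → ℝ² be a C¹ solution of (DS⁺): x' = x(x+1) − M₊(λ(N−1)x − z), z' = z(x+2+a−px), with x(t) > 0 and z(t) > 0 for all t ≤ t̂. Then z(t) < λ·α·(N+a) for all t ≤ t̂, where α = (2+a)/(p−1). In particular, a solution of (DS⁺) defined for all t ∈ ℝ with values in the open first quadrant remains inside the box (0, Ñ₊−2) × (0, λα(N+a)). -/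
open Real Set

/-- A function on a left half-line that lies strictly below the logistic field `-c y (y - K)`
wherever it is at least `K` stays below `K`: otherwise it would blow up in finite backward time. -/
lemma lt_of_deriv_lt_logistic {c K T : ℝ} (hc : 0 < c) (hK : 0 ≤ K) {w w' : ℝ → ℝ}
    (hw : ∀ t, t ≤ T → HasDerivAt w (w' t) t)
    (hlt : ∀ t, t ≤ T → K ≤ w t → w' t < -c * w t * (w t - K)) :
    ∀ t, t ≤ T → w t < K := by
  intro t₀ ht₀
  by_contra! h₀
  have hneg : ∀ t, t ≤ T → K ≤ w t → w' t < 0 := fun t ht hKt =>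
    (hlt t ht hKt).trans_le <| by
      have : 0 ≤ c * w t * (w t - K) :=
        mul_nonneg (mul_nonneg hc.le (hK.trans hKt)) (sub_nonneg.2 hKt)
      linarith
  have barrier : ∀ t₁, t₁ ≤ T → K ≤ w t₁ → ∀ t, t ≤ t₁ → w t₁ ≤ w t := by
    intro t₁ ht₁ hKt₁ t ht
    have hrev : ∀ s, 0 ≤ s → HasDerivAt (fun s => -w (t₁ - s)) (w' (t₁ - s)) s := by
      intro s hs
      have := ((hw (t₁ - s) (by linarith)).comp s ((hasDerivAt_id s).const_sub t₁)).fun_neg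
      simpa [Function.comp_def] using this
    have key := image_le_of_deriv_right_lt_deriv_boundary' (a := 0) (b := t₁ - t)
      (f := fun s => -w (t₁ - s)) (f' := fun s => w' (t₁ - s))
      (B := fun _ => -w t₁) (B' := fun _ => 0)
      (fun s hs => (hrev s hs.1).continuousAt.continuousWithinAt)
      (fun s hs => (hrev s hs.1).hasDerivWithinAt) (by simp)
      continuousOn_const (fun s _ => hasDerivWithinAt_const _ _ _)
      (fun s hs heq => hneg _ (by linarith [hs.1]) (by linarith))
    have := key (x := t₁ - t) ⟨by linarith, le_rfl⟩
    simp only [sub_sub_cancel] at this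
    linarith
  obtain ⟨t₁, ht₁₀, h₁⟩ : ∃ t₁ < t₀, K < w t₁ := by
    by_contra! hle
    have hconst : ∀ t, t < t₀ → w t = w t₀ := fun t ht =>
      le_antisymm ((hle t ht).trans h₀) (barrier t₀ ht₀ h₀ t ht.le)
    have heq : w =ᶠ[nhds (t₀ - 1)] fun _ => w t₀ := by
      filter_upwards [Iio_mem_nhds (sub_one_lt t₀)] with t ht using hconst t ht
    have hzero := (hw (t₀ - 1) (by linarith)).unique
      ((hasDerivAt_const (t₀ - 1) (w t₀)).congr_of_eventuallyEq heq)
    have := hneg (t₀ - 1) (by linarith) (by rw [hconst _ (by linarith)]; exact h₀)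
    linarith
  have ht₁ : t₁ ≤ T := ht₁₀.le.trans ht₀
  have hgt : ∀ t, t ≤ t₁ → K < w t := fun t ht => h₁.trans_le (barrier t₁ ht₁ h₁.le t ht)
  have hderiv : ∀ t, t ≤ t₁ →
      HasDerivAt (fun t => (w t - K)⁻¹ - c * t) (-w' t / (w t - K) ^ 2 - c) t := by
    intro t ht
    simpa using (((hw t (ht.trans ht₁)).sub_const K).fun_inv
      (sub_pos.2 (hgt t ht)).ne').fun_sub ((hasDerivAt_id t).const_mul c)
  have hmono : MonotoneOn (fun t => (w t - K)⁻¹ - c * t) (Iic t₁) := by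
    refine monotoneOn_of_hasDerivWithinAt_nonneg (convex_Iic t₁)
      (fun t ht => (hderiv t ht).continuousAt.continuousWithinAt)
      (fun t ht => (hderiv t (interior_subset (s := Iic t₁) ht)).hasDerivWithinAt) ?_
    intro t ht
    replace ht : t ≤ t₁ := interior_subset (s := Iic t₁) ht
    have hd := sub_pos.2 (hgt t ht)
    have hl := hlt t (ht.trans ht₁) (hgt t ht).le
    rw [sub_nonneg, le_div_iff₀ (pow_pos hd 2)]
    nlinarith [mul_nonneg (mul_nonneg hc.le hd.le) hK]
  have hv₁ : 0 < (w t₁ - K)⁻¹ := inv_pos.2 (sub_pos.2 h₁)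
  have hle : t₁ - (w t₁ - K)⁻¹ / c ≤ t₁ := sub_le_self _ (by positivity)
  have hm := hmono hle (le_refl t₁) hle
  have hv : 0 < (w (t₁ - (w t₁ - K)⁻¹ / c) - K)⁻¹ := inv_pos.2 (sub_pos.2 (hgt _ hle))
  simp only [mul_sub, mul_div_cancel₀ _ hc.ne'] at hm
  linarith

lemma Mplus_of_nonpos (lam Lam : ℝ) {s : ℝ} (hs : s ≤ 0) : Mplus lam Lam s = s / lam :=
  if_pos hs

lemma Mplus_lt_div {lam Lam s r : ℝ} (hlam : 0 < lam) (hLam : 0 < Lam) (hsr : s < r)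
    (hr : 0 ≤ r) : Mplus lam Lam s < r / Lam := by
  unfold Mplus
  split_ifs with hs
  · rcases hr.eq_or_lt with rfl | hr
    · simpa using div_neg_of_neg_of_pos hsr hlam
    · exact (div_nonpos_of_nonpos_of_nonneg hs hlam.le).trans_lt (div_pos hr hLam)
  · exact div_lt_div_of_pos_right hsr hLam

section Trajectory

variable {n lam Lam p a T : ℝ} {x z : ℝ → ℝ}

/-- Below the line `z = λ(n+a)x`: the ratio `z / x` obeys a logistic differential inequality. -/
lemma z_lt_mul_x (hlam : 0 < lam) (hp : 0 < p) (ha : -1 < a) (hna : 0 < n + a)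
    (hdx : ∀ t, t ≤ T → HasDerivAt x
      (x t * (x t + 1) - Mplus lam Lam (lam * (n - 1) * x t - z t)) t)
    (hdz : ∀ t, t ≤ T → HasDerivAt z (z t * (x t + 2 + a - p * x t)) t)
    (hx : ∀ t, t ≤ T → 0 < x t) (hz : ∀ t, t ≤ T → 0 < z t) :
    ∀ t, t ≤ T → z t < lam * (n + a) * x t := by
  intro t ht
  rw [← div_lt_iff₀ (hx t ht)]
  refine lt_of_deriv_lt_logistic (T := T) (inv_pos.2 hlam) (mul_pos hlam hna).le
    (w := fun t => z t / x t) (fun s hs => (hdz s hs).fun_div (hdx s hs) (hx s hs).ne') ?_ t ht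
  intro s hs hKs
  have hxs := hx s hs
  have hzs := hz s hs
  rw [le_div_iff₀ hxs] at hKs
  have hline : lam * (n - 1) * x s - z s ≤ 0 := by
    nlinarith [mul_pos (mul_pos hlam hxs) (by linarith : 0 < a + 1)]
  rw [Mplus_of_nonpos _ _ hline, ← sub_pos]
  have hval : -lam⁻¹ * (z s / x s) * (z s / x s - lam * (n + a)) -
      (z s * (x s + 2 + a - p * x s) * x s -
        z s * (x s * (x s + 1) - (lam * (n - 1) * x s - z s) / lam)) / x s ^ 2 = p * z s := by
    field_simp
    ring
  rw [hval]
  exact mul_pos hp hzs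

lemma z_lt_bound (hlam : 0 < lam) (hp : 1 < p) (ha : -1 < a) (hna : 0 < n + a)
    (hdx : ∀ t, t ≤ T → HasDerivAt x
      (x t * (x t + 1) - Mplus lam Lam (lam * (n - 1) * x t - z t)) t)
    (hdz : ∀ t, t ≤ T → HasDerivAt z (z t * (x t + 2 + a - p * x t)) t)
    (hx : ∀ t, t ≤ T → 0 < x t) (hz : ∀ t, t ≤ T → 0 < z t) :
    ∀ t, t ≤ T → z t < lam * ((2 + a) / (p - 1)) * (n + a) := by
  have hp' : 0 < p - 1 := sub_pos.2 hp
  have h2a : 0 < 2 + a := by linarith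
  refine lt_of_deriv_lt_logistic (c := (p - 1) / (lam * (n + a))) (by positivity) (by positivity)
    hdz ?_
  intro t ht _
  have hlt := (div_lt_iff₀' (mul_pos hlam hna)).2
    (z_lt_mul_x hlam (one_pos.trans hp) ha hna hdx hdz hx hz t ht)
  have hval : -((p - 1) / (lam * (n + a))) * z t * (z t - lam * ((2 + a) / (p - 1)) * (n + a)) =
      z t * (2 + a - (p - 1) * (z t / (lam * (n + a)))) := by
    field_simp
    ring
  rw [hval]
  refine mul_lt_mul_of_pos_left ?_ (hz t ht)
  linarith [mul_lt_mul_of_pos_left hlt hp']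

lemma x_lt_bound (hlam : 0 < lam) (hLam : 0 < Lam) (hn : 1 ≤ n)
    (hN : 1 ≤ lam / Lam * (n - 1))
    (hdx : ∀ t, HasDerivAt x
      (x t * (x t + 1) - Mplus lam Lam (lam * (n - 1) * x t - z t)) t)
    (hx : ∀ t, 0 < x t) (hz : ∀ t, 0 < z t) (t : ℝ) :
    x t < lam / Lam * (n - 1) - 1 := by
  have hrev : ∀ s, s ≤ -t → HasDerivAt (fun s => x (-s))
      (-(x (-s) * (x (-s) + 1) - Mplus lam Lam (lam * (n - 1) * x (-s) - z (-s)))) s := by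
    intro s _
    simpa [Function.comp_def] using (hdx (-s)).comp s (hasDerivAt_neg s)
  have key := lt_of_deriv_lt_logistic (c := 1) (K := lam / Lam * (n - 1) - 1) one_pos
    (sub_nonneg.2 hN) hrev ?_ (-t) le_rfl
  · simpa using key
  · intro s _ _
    have hM := Mplus_lt_div hlam hLam (sub_lt_self (lam * (n - 1) * x (-s)) (hz (-s)))
      (mul_nonneg (mul_nonneg hlam.le (sub_nonneg.2 hn)) (hx (-s)).le)
    have hval : lam * (n - 1) * x (-s) / Lam = lam / Lam * (n - 1) * x (-s) := by ring
    rw [hval] at hM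
    linarith

end Trajectory

/-- A priori bound: a trajectory of (DS⁺) staying in the open first quadrant for
all backward times `t ≤ tHat` satisfies `z(t) < λα(N+a)`; in particular a globally
defined first-quadrant trajectory stays in the box `(0,Ñ₊-2) × (0,λα(N+a))`. -/
theorem backward_trajectory_z_bound
    (N : ℕ) (hN : 3 ≤ N) (lam Lam : ℝ) (hlam : 0 < lam) (hlL : lam ≤ Lam)
    (p a : ℝ) (hp : 1 < p) (ha : -1 < a)
    (Nt : ℝ) (hNtdef : Nt = lam / Lam * ((N : ℝ) - 1) + 1) (hNt : 2 < Nt)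
    (α : ℝ) (hα : α = (2 + a) / (p - 1))
    (tHat : ℝ) (x z : ℝ → ℝ)
    (hdx : ∀ t, t ≤ tHat → HasDerivAt x
      (x t * (x t + 1) - Mplus lam Lam (lam * ((N : ℝ) - 1) * x t - z t)) t)
    (hdz : ∀ t, t ≤ tHat → HasDerivAt z (z t * (x t + 2 + a - p * x t)) t)
    (hxpos : ∀ t, t ≤ tHat → 0 < x t) (hzpos : ∀ t, t ≤ tHat → 0 < z t) :
    (∀ t, t ≤ tHat → z t < lam * α * ((N : ℝ) + a)) ∧
    (∀ x' z' : ℝ → ℝ,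
      (∀ t : ℝ, HasDerivAt x'
        (x' t * (x' t + 1) - Mplus lam Lam (lam * ((N : ℝ) - 1) * x' t - z' t)) t) →
      (∀ t : ℝ, HasDerivAt z' (z' t * (x' t + 2 + a - p * x' t)) t) →
      (∀ t : ℝ, 0 < x' t ∧ 0 < z' t) →
      ∀ t : ℝ, x' t ∈ Ioo (0 : ℝ) (Nt - 2) ∧
        z' t ∈ Ioo (0 : ℝ) (lam * α * ((N : ℝ) + a))) := by
  have hn : (3 : ℝ) ≤ N := by exact_mod_cast hN
  have hna : 0 < (N : ℝ) + a := by linarith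
  subst hα hNtdef
  refine ⟨z_lt_bound hlam hp ha hna hdx hdz hxpos hzpos, ?_⟩
  intro x' z' hdx' hdz' hpos t
  refine ⟨⟨(hpos t).1, ?_⟩, (hpos t).2, ?_⟩
  · have := x_lt_bound hlam (hlam.trans_le hlL) (by linarith) (by linarith) hdx'
      (fun t => (hpos t).1) (fun t => (hpos t).2) t
    linarith
  · exact z_lt_bound hlam hp ha hna (fun s _ => hdx' s) (fun s _ => hdz' s)
      (fun s _ => (hpos s).1) (fun s _ => (hpos s).2) t le_rfl
end

section
/- Let u be a positive C² solution of (P₊) on an interval I ⊆ (0,∞). (i) If u'(r) > 0 for all r ∈ I, then the function r ↦ u'(r)²/(2r^a) + u(r)^{p+1}/(Λ(p+1)) is strictly decreasing on I. (ii) If u'(r) < 0 for all r ∈ I, then the function r ↦ u'(r)²/(2r^a) + u(r)^{p+1}/(λ(p+1)) is strictly decreasing on I. (These are the energies 𝓔_Λ and 𝓔_λ, so the combined energy 𝓔 is piecewise monotone decreasing on {u' ≠ 0}.) -/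
open Real Set

/-- If `u` is `C²` on an interval `I ⊆ (0, ∞)` and `u' ≠ 0` there, the energy with parameter `σ` is
strictly decreasing on `I` as soon as `r ^ a` times its derivative is negative inside `I`. -/
theorem energy_strictAntiOn {p a σ : ℝ} (hp : 0 < p + 1) {I : Set ℝ} (hI : I ⊆ Ioi 0)
    (hconn : I.OrdConnected) {u : ℝ → ℝ} (hu : ContDiffOn ℝ 2 u I) (hupos : ∀ r ∈ I, 0 < u r)
    (hne : ∀ r ∈ I, deriv u r ≠ 0)
    (hneg : ∀ r ∈ I, deriv u r * deriv (deriv u) r - a * deriv u r ^ 2 / (2 * r)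
      + r ^ a * u r ^ p * deriv u r / σ < 0) :
    StrictAntiOn
      (fun r : ℝ => (deriv u r) ^ 2 / (2 * r ^ a) + u r ^ (p + 1) / (σ * (p + 1))) I := by
  rcases I.subsingleton_or_nontrivial with hsub | hnt
  · exact hsub.strictAntiOn _
  have hconv : Convex ℝ I := hconn.convex
  have huniq : UniqueDiffOn ℝ I :=
    uniqueDiffOn_convex hconv (hconv.nontrivial_iff_nonempty_interior.1 hnt)
  have hdw : EqOn (deriv u) (derivWithin u I) I := fun r hr =>
    ((differentiableAt_of_deriv_ne_zero (hne r hr)).derivWithin (huniq r hr)).symm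
  have hdc : ContinuousOn (deriv u) I :=
    (hu.continuousOn_derivWithin huniq (by norm_num)).congr hdw
  have hrc : ContinuousOn (fun r : ℝ => 2 * r ^ a) I :=
    continuousOn_const.mul
      (continuousOn_id.rpow_const fun r hr => Or.inl (ne_of_gt (hI hr)))
  refine strictAntiOn_of_deriv_neg hconv ?_ ?_
  · refine ((hdc.pow 2).div hrc fun r hr => ?_).add
      ((hu.continuousOn.rpow_const fun r hr => Or.inl (hupos r hr).ne').div_const _)
    have : 0 < r ^ a := rpow_pos_of_pos (hI hr) a
    positivity
  · intro r hr
    have hrI : r ∈ I := interior_subset hr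
    have hr0 : 0 < r := hI hrI
    have hA : 0 < r ^ a := rpow_pos_of_pos hr0 a
    have hu' : HasDerivAt u (deriv u r) r :=
      (differentiableAt_of_deriv_ne_zero (hne r hrI)).hasDerivAt
    have hcd : ContDiffOn ℝ 1 (deriv u) (interior I) :=
      ((contDiffOn_succ_iff_deriv_of_isOpen (n := 1) isOpen_interior).1
        (by simpa [one_add_one_eq_two] using hu.mono interior_subset)).2.2
    have hu'' : HasDerivAt (deriv u) (deriv (deriv u) r) r :=
      ((hcd.differentiableOn (by norm_num)).differentiableAt
        (isOpen_interior.mem_nhds hr)).hasDerivAt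
    have hE := ((hu''.pow 2).div
      ((hasDerivAt_rpow_const (p := a) (Or.inl hr0.ne')).const_mul 2) (by positivity)).add
      ((hu'.rpow_const (p := p + 1) (Or.inl (hupos r hrI).ne')).div_const (σ * (p + 1)))
    refine lt_of_eq_of_lt (hE.deriv.trans ?_) (div_neg_of_neg_of_pos (hneg r hrI) hA)
    rw [rpow_sub_one hr0.ne', add_sub_cancel_right,
      show deriv u r * (p + 1) * u r ^ p / (σ * (p + 1)) = u r ^ p * deriv u r / σ by
        rw [show deriv u r * (p + 1) * u r ^ p = u r ^ p * deriv u r * (p + 1) by ring,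
          mul_div_mul_right _ _ hp.ne']]
    have hw : (deriv u r * deriv (deriv u) r - a * deriv u r ^ 2 / (2 * r)
        + r ^ a * u r ^ p * deriv u r / σ) / r ^ a
        = (deriv u r * deriv (deriv u) r - a * deriv u r ^ 2 / (2 * r)) / r ^ a
          + u r ^ p * deriv u r / σ := by
      rw [add_div, show r ^ a * u r ^ p * deriv u r / σ = r ^ a * (u r ^ p * deriv u r / σ) by ring,
        mul_div_cancel_left₀ _ hA.ne']
    rw [hw]
    congr 1
    simp only [Nat.cast_ofNat, Pi.pow_apply, Nat.add_one_sub_one, pow_one]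
    field_simp

/-- Monotonicity of the energy `𝓔_σ(r) = u'(r)²/(2r^a) + u(r)^{p+1}/(σ(p+1))` for
positive solutions of (P₊): it is strictly decreasing with `σ = Λ` where `u' > 0`
and with `σ = λ` where `u' < 0`. -/
theorem energy_E_decreasing
    (N : ℕ) (hN : 3 ≤ N) (lam Lam : ℝ) (hlam : 0 < lam) (hlL : lam ≤ Lam)
    (p a : ℝ) (hp : 1 < p) (ha : -1 < a)
    (hNt : 2 < lam / Lam * ((N : ℝ) - 1) + 1)
    (I : Set ℝ) (hI : I ⊆ Ioi 0) (hconn : I.OrdConnected)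
    (u : ℝ → ℝ) (hu : ContDiffOn ℝ 2 u I) (hupos : ∀ r ∈ I, 0 < u r)
    (hode : ∀ r ∈ I, deriv (deriv u) r =
      Mplus lam Lam
        (-(((N : ℝ) - 1) * mplus lam Lam (deriv u r)) / r - r ^ a * u r ^ p)) :
    ((∀ r ∈ I, 0 < deriv u r) →
      StrictAntiOn
        (fun r : ℝ => (deriv u r) ^ 2 / (2 * r ^ a) + u r ^ (p + 1) / (Lam * (p + 1)))
        I) ∧
    ((∀ r ∈ I, deriv u r < 0) →
      StrictAntiOn
        (fun r : ℝ => (deriv u r) ^ 2 / (2 * r ^ a) + u r ^ (p + 1) / (lam * (p + 1)))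
        I) := by
  have hLam : 0 < Lam := hlam.trans_le hlL
  have hN' : (3 : ℝ) ≤ N := by exact_mod_cast hN
  have hinv : Lam⁻¹ ≤ lam⁻¹ := inv_anti₀ hlam hlL
  have hw : ∀ r ∈ I, 0 < r ^ a * u r ^ p := fun r hr =>
    mul_pos (rpow_pos_of_pos (hI hr) a) (rpow_pos_of_pos (hupos r hr) p)
  constructor
  · intro hd
    refine energy_strictAntiOn (by linarith) hI hconn hu hupos (fun r hr => (hd r hr).ne') ?_
    intro r hr
    have hr0 : 0 < r := hI hr
    have hd0 := hd r hr
    have hw0 := hw r hr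
    rw [hode r hr, mplus, if_neg hd0.not_ge]
    generalize deriv u r = d at *
    generalize r ^ a * u r ^ p = w at *
    have hX : -((N - 1) * (Lam * d)) / r - w ≤ 0 := by
      have : 0 < (N - 1) * (Lam * d) / r := by
        have : (0 : ℝ) < N - 1 := by linarith
        positivity
      rw [neg_div]
      linarith
    rw [Mplus, if_pos hX]
    have hratio : 1 ≤ Lam / lam := (one_le_div hlam).2 hlL
    have h1 : 0 < d ^ 2 / r * ((N - 1) * (Lam / lam) + a / 2) :=
      mul_pos (by positivity) (by nlinarith)
    have h2 : 0 ≤ w * d * (lam⁻¹ - Lam⁻¹) :=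
      mul_nonneg (by positivity) (sub_nonneg.2 hinv)
    have h3 : d * ((-((N - 1) * (Lam * d)) / r - w) / lam) - a * d ^ 2 / (2 * r) + w * d / Lam
        = -(d ^ 2 / r * ((N - 1) * (Lam / lam) + a / 2)) - w * d * (lam⁻¹ - Lam⁻¹) := by
      field_simp
      ring
    linarith
  · intro hd
    refine energy_strictAntiOn (by linarith) hI hconn hu hupos (fun r hr => (hd r hr).ne) ?_
    intro r hr
    have hr0 : 0 < r := hI hr
    have hd0 := hd r hr
    have hw0 := hw r hr
    rw [hode r hr, mplus, if_pos hd0.le]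
    generalize deriv u r = d at *
    generalize r ^ a * u r ^ p = w at *
    have hq : 0 < d ^ 2 / r := div_pos (sq_pos_of_neg hd0) hr0
    rw [Mplus]
    split_ifs with hX
    · have h1 : 0 < d ^ 2 / r * ((N - 1) + a / 2) := mul_pos hq (by linarith)
      have h3 : d * ((-((N - 1) * (lam * d)) / r - w) / lam) - a * d ^ 2 / (2 * r) + w * d / lam
          = -(d ^ 2 / r * ((N - 1) + a / 2)) := by
        field_simp
        ring
      linarith
    · have h1 : 0 < d ^ 2 / r * (lam / Lam * (N - 1) + a / 2) := mul_pos hq (by linarith)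
      have h2 : w * d * (lam⁻¹ - Lam⁻¹) ≤ 0 :=
        mul_nonpos_of_nonpos_of_nonneg (mul_neg_of_pos_of_neg hw0 hd0).le (sub_nonneg.2 hinv)
      have h3 : d * ((-((N - 1) * (lam * d)) / r - w) / Lam) - a * d ^ 2 / (2 * r) + w * d / lam
          = -(d ^ 2 / r * (lam / Lam * (N - 1) + a / 2)) + w * d * (lam⁻¹ - Lam⁻¹) := by
        field_simp
        ring
      linarith
end

section
/- Let u be a positive C² solution of (P₊) on an interval I ⊆ (0,∞), and set A = 2(Ñ₋−1). (i) If u'(r) ≥ 0 for all r in a subinterval J ⊆ I, then the function E_λ(r) = r^A·( u'(r)²/2 + r^a·u(r)^{p+1}/(λ(p+1)) ) is monotone nondecreasing on J. (ii) If u'(r) ≤ 0 for all r in a subinterval J ⊆ I, then the function E_Λ(r) = r^A·( u'(r)²/2 + r^a·u(r)^{p+1}/(Λ(p+1)) ) is monotone nondecreasing on J. -/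
open Real Set

/-- If `deriv (deriv u)` does not vanish at the zeros of `deriv u`, then `deriv u` is continuous on
a set where `u` is `C²`, including at boundary points, where `u` need not be differentiable. -/
theorem continuousOn_deriv_of_deriv_deriv_ne_zero {I : Set ℝ} (hI : UniqueDiffOn ℝ I)
    (hcl : I ⊆ closure (interior I)) {u : ℝ → ℝ} (hu : ContDiffOn ℝ 2 u I)
    (h : ∀ r ∈ I, deriv u r = 0 → deriv (deriv u) r ≠ 0) :
    ContinuousOn (deriv u) I := by
  have hc : ContinuousOn (derivWithin u I) I := hu.continuousOn_derivWithin hI (by norm_num)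
  have hev : ∀ r ∈ I, derivWithin u I r = deriv u r := by
    intro r hr
    by_cases h0 : deriv u r = 0
    · have hint : interior I ⊆ I := interior_subset
      have : (nhdsWithin r (interior I)).NeBot := mem_closure_iff_nhdsWithin_neBot.1 (hcl hr)
      have h1 := (hc r hr).mono hint
      have h2 := (differentiableAt_of_deriv_ne_zero (h r hr h0)).continuousAt.continuousWithinAt
        (s := interior I)
      refine tendsto_nhds_unique (h1.tendsto.congr' ?_) h2.tendsto
      filter_upwards [self_mem_nhdsWithin] with x hx
      exact derivWithin_of_mem_nhds (mem_interior_iff_mem_nhds.1 hx)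
    · exact (differentiableAt_of_deriv_ne_zero h0).derivWithin (hI r hr)
  exact hc.congr fun r hr => (hev r hr).symm

/-- A weighted energy `r ^ A * (u' ^ 2 / 2 + r ^ a * u ^ (p + 1) / (σ * (p + 1)))` is nondecreasing
as soon as the part of its derivative that carries a factor `u'` is nonnegative. -/
theorem monotoneOn_weighted_energy {J : Set ℝ} (hJ : J.OrdConnected) (hpos : J ⊆ Ioi 0)
    {u : ℝ → ℝ} (hupos : ∀ r ∈ J, 0 < u r) (hu : ContinuousOn u J)
    (hu' : ContinuousOn (deriv u) J)
    (hd : ∀ r ∈ interior J, DifferentiableAt ℝ u r)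
    (hd' : ∀ r ∈ interior J, DifferentiableAt ℝ (deriv u) r)
    {A a p σ : ℝ} (hp : 0 < p + 1) (hσ : 0 < σ) (hA : 0 ≤ A + a)
    (h : ∀ r ∈ interior J,
      0 ≤ deriv u r * (r * deriv (deriv u) r + A / 2 * deriv u r + r * (r ^ a * u r ^ p) / σ)) :
    MonotoneOn (fun r : ℝ => r ^ A *
      ((deriv u r) ^ 2 / 2 + r ^ a * u r ^ (p + 1) / (σ * (p + 1)))) J := by
  have hderiv : ∀ r ∈ interior J, HasDerivAt (fun r : ℝ => r ^ A *
      ((deriv u r) ^ 2 / 2 + r ^ a * u r ^ (p + 1) / (σ * (p + 1))))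
      (r ^ A / r * (deriv u r * (r * deriv (deriv u) r + A / 2 * deriv u r
          + r * (r ^ a * u r ^ p) / σ)
        + (A + a) * (r ^ a * u r ^ (p + 1)) / (σ * (p + 1)))) r := by
    intro r hr
    have hr0 : 0 < r := hpos (interior_subset hr)
    have hur := hupos r (interior_subset hr)
    have hpow (b : ℝ) : HasDerivAt (fun r : ℝ => r ^ b) (b * (r ^ b / r)) r := by
      simpa [Real.rpow_sub_one hr0.ne'] using Real.hasDerivAt_rpow_const (p := b) (Or.inl hr0.ne')
    have hup := (hd r hr).hasDerivAt.rpow_const (p := p + 1) (Or.inl hur.ne')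
    refine ((hpow A).mul ((((hd' r hr).hasDerivAt.pow 2).div_const 2).add
      (((hpow a).mul hup).div_const (σ * (p + 1))))).congr_deriv ?_
    simp only [Pi.mul_apply, Pi.add_apply, Pi.pow_apply, add_sub_cancel_right]
    field_simp
    ring
  refine monotoneOn_of_deriv_nonneg hJ.convex ?_
    (fun r hr => (hderiv r hr).differentiableAt.differentiableWithinAt) fun r hr => ?_
  · have hpow (b : ℝ) : ContinuousOn (fun r : ℝ => r ^ b) J :=
      continuousOn_id.rpow_const fun r hr => Or.inl (hpos hr).ne'
    exact (hpow A).mul (((hu'.pow 2).div_const 2).add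
      (((hpow a).mul (hu.rpow_const fun r hr => Or.inl (hupos r hr).ne')).div_const _))
  · rw [(hderiv r hr).deriv]
    have hr0 : 0 < r := hpos (interior_subset hr)
    have hur := hupos r (interior_subset hr)
    have := h r hr
    positivity

/-- The differential inequality behind the monotonicity of the energy where `u' ≥ 0`. -/
theorem mul_Mplus_nonneg_of_nonneg {lam Lam n r v g : ℝ} (hlam : 0 < lam) (hlL : lam ≤ Lam)
    (hn : 0 ≤ n) (hr : 0 < r) (hg : 0 ≤ g) (hv : 0 ≤ v) :
    0 ≤ v * (r * Mplus lam Lam (-(n * mplus lam Lam v) / r - g) + Lam / lam * n * v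
      + r * g / lam) := by
  have hLam : 0 < Lam := hlam.trans_le hlL
  have hm : mplus lam Lam v = Lam * v := by
    unfold mplus
    split_ifs with h
    · simp [le_antisymm h hv]
    · rfl
  have hs : -(n * (Lam * v)) / r - g ≤ 0 := by
    have : 0 ≤ n * (Lam * v) / r := by positivity
    rw [neg_div]
    linarith
  rw [hm, Mplus, if_pos hs]
  apply le_of_eq
  field_simp
  ring

/-- The differential inequality behind the monotonicity of the energy where `u' ≤ 0`. -/
theorem mul_Mplus_nonneg_of_nonpos {lam Lam n r v g : ℝ} (hlam : 0 < lam) (hlL : lam ≤ Lam)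
    (hn : 0 ≤ n) (hr : 0 < r) (hg : 0 ≤ g) (hv : v ≤ 0) :
    0 ≤ v * (r * Mplus lam Lam (-(n * mplus lam Lam v) / r - g) + Lam / lam * n * v
      + r * g / Lam) := by
  have hLam : 0 < Lam := hlam.trans_le hlL
  have h1 : 1 ≤ Lam / lam := (one_le_div hlam).2 hlL
  have hnv : n * v ≤ 0 := mul_nonpos_of_nonneg_of_nonpos hn hv
  apply mul_nonneg_of_nonpos_of_nonpos hv
  rw [mplus, if_pos hv, Mplus]
  split_ifs
  · have h2 : r * g / Lam ≤ r * g / lam := by gcongr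
    have h3 : (Lam / lam - 1) * (n * v) ≤ 0 :=
      mul_nonpos_of_nonneg_of_nonpos (sub_nonneg.2 h1) hnv
    have h4 : r * ((-(n * (lam * v)) / r - g) / lam) = -(n * v) - r * g / lam := by
      field_simp
    rw [h4]
    linarith
  · have h2 : lam / Lam ≤ 1 := (div_le_one hLam).2 hlL
    have h3 : (Lam / lam - lam / Lam) * (n * v) ≤ 0 :=
      mul_nonpos_of_nonneg_of_nonpos (sub_nonneg.2 (h2.trans h1)) hnv
    have h4 : r * ((-(n * (lam * v)) / r - g) / Lam) = -(lam / Lam * (n * v)) - r * g / Lam := by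
      field_simp
    rw [h4]
    linarith

/-- Monotonicity of the weighted energies, with `A = 2(Ñ₋-1)`:
`E_λ(r) = r^A (u'(r)²/2 + r^a u(r)^{p+1}/(λ(p+1)))` is nondecreasing where
`u' ≥ 0`, and `E_Λ(r) = r^A (u'(r)²/2 + r^a u(r)^{p+1}/(Λ(p+1)))` is
nondecreasing where `u' ≤ 0`. -/
theorem energy_Esigma_increasing
    (N : ℕ) (hN : 3 ≤ N) (lam Lam : ℝ) (hlam : 0 < lam) (hlL : lam ≤ Lam)
    (p a : ℝ) (hp : 1 < p) (ha : -1 < a)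
    (hNt : 2 < lam / Lam * ((N : ℝ) - 1) + 1)
    (Nm : ℝ) (hNm : Nm = Lam / lam * ((N : ℝ) - 1) + 1)
    (I : Set ℝ) (hI : I ⊆ Ioi 0) (hconn : I.OrdConnected)
    (u : ℝ → ℝ) (hu : ContDiffOn ℝ 2 u I) (hupos : ∀ r ∈ I, 0 < u r)
    (hode : ∀ r ∈ I, deriv (deriv u) r =
      Mplus lam Lam
        (-(((N : ℝ) - 1) * mplus lam Lam (deriv u r)) / r - r ^ a * u r ^ p)) :
    (∀ J : Set ℝ, J ⊆ I → J.OrdConnected → (∀ r ∈ J, 0 ≤ deriv u r) →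
      MonotoneOn
        (fun r : ℝ => r ^ (2 * (Nm - 1)) *
          ((deriv u r) ^ 2 / 2 + r ^ a * u r ^ (p + 1) / (lam * (p + 1)))) J) ∧
    (∀ J : Set ℝ, J ⊆ I → J.OrdConnected → (∀ r ∈ J, deriv u r ≤ 0) →
      MonotoneOn
        (fun r : ℝ => r ^ (2 * (Nm - 1)) *
          ((deriv u r) ^ 2 / 2 + r ^ a * u r ^ (p + 1) / (Lam * (p + 1)))) J) := by
  have hNr : (3 : ℝ) ≤ N := by exact_mod_cast hN
  have hLam : 0 < Lam := hlam.trans_le hlL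
  have hn : (0 : ℝ) ≤ N - 1 := by linarith
  have hA : 2 * (Nm - 1) / 2 = Lam / lam * ((N : ℝ) - 1) := by rw [hNm]; ring
  have hAa : 0 ≤ 2 * (Nm - 1) + a := by
    have h1 : 1 ≤ Lam / lam := (one_le_div hlam).2 hlL
    rw [hNm]
    nlinarith
  have hne : ∀ r ∈ I, deriv u r = 0 → deriv (deriv u) r ≠ 0 := by
    intro r hr h0
    have hr0 : 0 < r := hI hr
    have hg : 0 < r ^ a * u r ^ p :=
      mul_pos (rpow_pos_of_pos hr0 _) (rpow_pos_of_pos (hupos r hr) _)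
    have hs : -(((N : ℝ) - 1) * mplus lam Lam 0) / r - r ^ a * u r ^ p < 0 := by
      simpa [mplus] using hg
    rw [hode r hr, h0, Mplus, if_pos hs.le]
    exact (div_neg_of_neg_of_pos hs hlam).ne
  have main : ∀ σ : ℝ, 0 < σ → ∀ J : Set ℝ, J ⊆ I → J.OrdConnected →
      (∀ r ∈ J, 0 ≤ deriv u r * (r * deriv (deriv u) r + 2 * (Nm - 1) / 2 * deriv u r
        + r * (r ^ a * u r ^ p) / σ)) →
      MonotoneOn (fun r : ℝ => r ^ (2 * (Nm - 1)) *
        ((deriv u r) ^ 2 / 2 + r ^ a * u r ^ (p + 1) / (σ * (p + 1)))) J := by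
    intro σ hσ J hJI hJ h
    rcases J.subsingleton_or_nontrivial with hJs | hJn
    · exact hJs.monotoneOn _
    have hcd : ∀ r ∈ interior J, ContDiffAt ℝ 2 u r := fun r hr =>
      hu.contDiffAt (mem_interior_iff_mem_nhds.1 (interior_mono hJI hr))
    have hint : (interior I).Nonempty :=
      hconn.convex.nontrivial_iff_nonempty_interior.1 (hJn.mono hJI)
    have hud : UniqueDiffOn ℝ I := uniqueDiffOn_convex hconn.convex hint
    have hcl : I ⊆ closure (interior I) :=
      (hconn.convex (𝕜 := ℝ)).closure_interior_eq_closure_of_nonempty_interior hint ▸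
        subset_closure
    have hu1 : ContDiffOn ℝ 1 (deriv u) (interior I) :=
      (hu.mono interior_subset).deriv_of_isOpen isOpen_interior (by norm_num)
    exact monotoneOn_weighted_energy hJ (hJI.trans hI) (fun r hr => hupos r (hJI hr))
      (hu.continuousOn.mono hJI)
      ((continuousOn_deriv_of_deriv_deriv_ne_zero hud hcl hu hne).mono hJI)
      (fun r hr => (hcd r hr).differentiableAt (by norm_num))
      (fun r hr => (hu1.differentiableOn (by norm_num)).differentiableAt
        (isOpen_interior.mem_nhds (interior_mono hJI hr)))
      (by linarith) hσ hAa fun r hr => h r (interior_subset hr)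
  have hg : ∀ r ∈ I, 0 ≤ r ^ a * u r ^ p := fun r hr =>
    mul_nonneg (rpow_nonneg (hI hr).le _) (rpow_nonneg (hupos r hr).le _)
  refine ⟨fun J hJI hJ hs => main lam hlam J hJI hJ fun r hr => ?_,
    fun J hJI hJ hs => main Lam hLam J hJI hJ fun r hr => ?_⟩
  · rw [hode r (hJI hr), hA]
    exact mul_Mplus_nonneg_of_nonneg hlam hlL hn (hI (hJI hr)) (hg r (hJI hr)) (hs r hr)
  · rw [hode r (hJI hr), hA]
    exact mul_Mplus_nonneg_of_nonpos hlam hlL hn (hI (hJI hr)) (hg r (hJI hr)) (hs r hr)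
end
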